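/- arXiv:math/0208085 — 9 statements merged into one kernel-verified Lean document; each statement's English description precedes it below -/
import Mathlib

section
/- Let A be a unital AF algebra, let a ∈ A be a nonzero selfadjoint element, let p ∈ A be a projection, let ε > 0, and let n ∈ ℕ satisfy n > 1/ε. Then there exists a projection q ∈ A such that p ≤ q, ‖q a − a q‖ < ε ‖a‖, and q is Murray–von Neumann subequivalent to the direct sum of 2n copies of p; that is, there exists an element v of the matrix algebra M_{2n}(A) such that v* v is the matrix with q in the (1,1) entry and 0 in all other entries, and v v* is a subprojection of the diagonal matrix diag(p, p, …, p) (i.e., (v v*) · diag(p, …, p) = v v*). -/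
open Matrix

/-- A unital C*-algebra is AF (approximately finite dimensional) if there is an increasing
sequence of finite-dimensional *-subalgebras, each containing the unit, whose union is dense. -/
def IsAFAlgebra (A : Type*) [CStarAlgebra A] : Prop :=
  ∃ B : ℕ → StarSubalgebra ℂ A, Monotone B ∧ (∀ k, FiniteDimensional ℂ (B k)) ∧
    Dense (⋃ k, (B k : Set A))

section Helpers

variable {A : Type*} [CStarAlgebra A]

/-- Elements of a finite-dimensional star subalgebra have finite real spectrum. -/
lemma finite_spectrum_of_mem {B : StarSubalgebra ℂ A} [FiniteDimensional ℂ B] {b : A}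
    (hb : b ∈ B) : (spectrum ℝ b).Finite := by
  nontriviality A
  obtain ⟨P, hP, hPb⟩ := Algebra.IsAlgebraic.isAlgebraic (R := ℂ) (⟨b, hb⟩ : B)
  have hPb' : Polynomial.aeval b P = 0 := by
    have h := congrArg B.subtype hPb
    rwa [map_zero, ← Polynomial.aeval_algHom_apply] at h
  have hfin : (spectrum ℂ b).Finite := by
    refine (P.rootSet_finite ℂ).subset fun t ht => ?_
    have h := spectrum.subset_polynomial_aeval b P ⟨t, ht, rfl⟩
    rw [hPb', spectrum.zero_eq] at h
    simpa [Polynomial.mem_rootSet, hP] using h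
  rw [← spectrum.preimage_algebraMap ℂ]
  exact hfin.preimage Complex.ofReal_injective.injOn

lemma cfc_mem_of_finiteDimensional {B : StarSubalgebra ℂ A} [FiniteDimensional ℂ B] {b : A}
    (hb : b ∈ B) (f : ℝ → ℝ) : cfc f b ∈ B :=
  have : IsClosed (B : Set A) :=
    Submodule.closed_of_finiteDimensional (Subalgebra.toSubmodule B.toSubalgebra)
  cfc_mem (𝕜' := ℂ) f hb

lemma isStarProjection_cfc_ite {b : A} (hb : (spectrum ℝ b).Finite) (S : ℝ → Prop)
    [DecidablePred S] : IsStarProjection (cfc (fun t => if S t then (1 : ℝ) else 0) b) := by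
  refine ⟨?_, cfc_predicate _ _⟩
  rw [IsIdempotentElem, ← cfc_mul _ _ _ (hb.continuousOn _) (hb.continuousOn _)]
  refine cfc_congr fun t _ => ?_
  by_cases ht : S t <;> simp [ht]

/-- Polar normalisation: `y (y* y)^{-1/2}` is a partial isometry with initial projection
the support of `y* y`, provided `t ↦ t^{-1/2}` is continuous on the spectrum. -/
lemma star_mul_self_mul_cfc_inv_sqrt (y : A)
    (hg : ContinuousOn (fun t : ℝ => (√t)⁻¹) (spectrum ℝ (star y * y))) :
    star (y * cfc (fun t : ℝ => (√t)⁻¹) (star y * y)) *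
      (y * cfc (fun t : ℝ => (√t)⁻¹) (star y * y)) =
      cfc (fun t : ℝ => if t ≠ 0 then (1 : ℝ) else 0) (star y * y) := by
  set x := star y * y with hx
  have hxs : IsSelfAdjoint x := IsSelfAdjoint.star_mul_self y
  set k := cfc (fun t : ℝ => (√t)⁻¹) x with hk
  have hks : star k = k := (cfc_predicate (R := ℝ) _ x : IsSelfAdjoint k)
  have h : star (y * k) * (y * k) = k * x * k := by simp only [star_mul, hks, hx, mul_assoc]
  rw [h, hk]
  conv_lhs => enter [1, 2]; rw [← cfc_id' ℝ x]
  rw [← cfc_mul _ _ _ hg, ← cfc_mul _ _ _ (by fun_prop) hg]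
  refine cfc_congr fun t ht => ?_
  have ht0 : 0 ≤ t := spectrum_star_mul_self_nonneg t ht
  rcases ht0.eq_or_lt with rfl | ht0
  · simp
  · have : √t ≠ 0 := (Real.sqrt_pos.2 ht0).ne'
    simp only [ne_eq, ht0.ne', not_false_eq_true, if_true]
    field_simp
    exact (Real.sq_sqrt ht0.le).symm

/-- Right support projection of an element `y` such that `y* y` has finite spectrum. -/
lemma exists_support_projection (y : A) (hy : (spectrum ℝ (star y * y)).Finite) :
    ∃ r k l : A, IsStarProjection r ∧ star (y * k) * (y * k) = r ∧ y * r = y ∧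
      r = star y * l := by
  set x := star y * y with hx
  have hxs : IsSelfAdjoint x := IsSelfAdjoint.star_mul_self y
  set r := cfc (fun t : ℝ => if t ≠ 0 then (1 : ℝ) else 0) x with hr
  set k := cfc (fun t : ℝ => (√t)⁻¹) x with hk
  have hks : star k = k := (cfc_predicate (R := ℝ) _ x : IsSelfAdjoint k)
  have hrk : star (y * k) * (y * k) = r := star_mul_self_mul_cfc_inv_sqrt y (hy.continuousOn _)
  have hrp : IsStarProjection r := isStarProjection_cfc_ite hy _
  have hxk : k * x = x * k := ((Commute.refl x).cfc_real _).eq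
  refine ⟨r, k, y * k * k, hrp, hrk, ?_, ?_⟩
  · have hxr : x * r = x := by
      conv_lhs => enter [1]; rw [← cfc_id' ℝ x]
      rw [hr, ← cfc_mul _ _ _ (hy.continuousOn _) (hy.continuousOn _)]
      conv_rhs => rw [← cfc_id' ℝ x]
      refine cfc_congr fun t _ => ?_
      by_cases ht : t = 0 <;> simp [ht]
    have h0 : star (y * r - y) * (y * r - y) = 0 := by
      have : star (y * r - y) * (y * r - y) = (star r - 1) * (x * r - x) := by
        rw [star_sub, star_mul, hx]; noncomm_ring
      rw [this, hxr, sub_self, mul_zero]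
    exact sub_eq_zero.1 ((CStarRing.star_mul_self_eq_zero_iff _).1 h0)
  · rw [← hrk, star_mul, hks]
    calc k * star y * (y * k) = (k * x) * k := by rw [hx]; noncomm_ring
      _ = star y * (y * k * k) := by rw [hxk, hx]; noncomm_ring

/-- Two projections at distance less than one are unitarily equivalent. -/
lemma exists_unitary_conj_of_norm_sub_lt_one {p p' : A} (hp : IsStarProjection p)
    (hp' : IsStarProjection p') (h : ‖p - p'‖ < 1) :
    ∃ u ∈ unitary A, u * p' = p * u := by
  have hpp := hp.isIdempotentElem.eq
  have hpp' := hp'.isIdempotentElem.eq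
  have hps := hp.isSelfAdjoint.star_eq
  have hps' := hp'.isSelfAdjoint.star_eq
  set z := p * p' + (1 - p) * (1 - p') with hz
  have hzp : z * p' = p * z := by
    have h1 : z * p' = p * p' := by
      rw [hz]
      calc _ = p * (p' * p') + (1 - p) * (p' - p' * p') := by noncomm_ring
        _ = _ := by rw [hpp']; simp
    have h2 : p * z = p * p' := by
      rw [hz]
      calc _ = (p * p) * p' + (p - p * p) * (1 - p') := by noncomm_ring
        _ = _ := by rw [hpp]; simp
    rw [h1, h2]
  have hzu : IsUnit z := by
    have h1 : ‖1 - z‖ < 1 := by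
      have h2 : 1 - z = (2 * p - 1) * (p - p') := by
        rw [hz]
        calc _ = p + p' - 2 * (p * p') := by noncomm_ring
          _ = 2 * (p * p) - p - 2 * (p * p') + p' := by rw [hpp]; noncomm_ring
          _ = _ := by noncomm_ring
      rw [h2, CStarRing.norm_mem_unitary_mul _ hp.two_mul_sub_one_mem_unitary]
      exact h
    simpa using isUnit_one_sub_of_norm_lt_one h1
  have hmu : IsUnit (star z * z) := hzu.star.mul hzu
  have h0 : (0 : ℝ) ∉ spectrum ℝ (star z * z) := spectrum.zero_notMem ℝ hmu
  have hg : ContinuousOn (fun t : ℝ => (√t)⁻¹) (spectrum ℝ (star z * z)) := by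
    refine ContinuousOn.inv₀ Real.continuous_sqrt.continuousOn fun t ht => ?_
    have : t ≠ 0 := fun h => h0 (h ▸ ht)
    exact (Real.sqrt_pos.2 ((spectrum_star_mul_self_nonneg t ht).lt_of_ne' this)).ne'
  have hpol := star_mul_self_mul_cfc_inv_sqrt z hg
  have hone : cfc (fun t : ℝ => if t ≠ 0 then (1 : ℝ) else 0) (star z * z) = 1 := by
    rw [← cfc_one ℝ (star z * z) (IsSelfAdjoint.star_mul_self z)]
    refine cfc_congr fun t ht => ?_
    have : t ≠ 0 := fun h => h0 (h ▸ ht)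
    simp [this]
  set k := cfc (fun t : ℝ => (√t)⁻¹) (star z * z) with hk
  rw [hone] at hpol
  have hku : IsUnit k := by
    refine (isUnit_cfc_iff _ _ hg (IsSelfAdjoint.star_mul_self z)).2 fun t ht => ?_
    have : t ≠ 0 := fun h => h0 (h ▸ ht)
    exact inv_ne_zero
      (Real.sqrt_pos.2 ((spectrum_star_mul_self_nonneg t ht).lt_of_ne' this)).ne'
  have hcomm : Commute (star z * z) p' := by
    have hzp2 : p' * star z = star z * p := by
      have := congrArg star hzp
      simpa only [star_mul, hps, hps'] using this
    show star z * z * p' = p' * (star z * z)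
    rw [mul_assoc, hzp, ← mul_assoc, ← hzp2, mul_assoc]
  have hkp : k * p' = p' * k := (hcomm.cfc_real _).eq
  refine ⟨z * k, ?_, ?_⟩
  · refine Unitary.mem_iff.2 ⟨hpol, ?_⟩
    obtain ⟨w, hw⟩ := hzu.mul hku
    rw [← hw] at hpol ⊢
    rw [← Units.inv_eq_of_mul_eq_one_left hpol, Units.mul_inv]
  · rw [mul_assoc, hkp, ← mul_assoc, hzp, mul_assoc]

/-- The interval `[-R, R]` is cut into `2n` cells with centres `c i` and radius `R / (2n)`. -/
lemma exists_cell_decomposition {R : ℝ} (hR : 0 < R) {n : ℕ} (hn : 0 < n) :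
    ∃ (κ : ℝ → Fin (2 * n)) (c : Fin (2 * n) → ℝ),
      ∀ t, |t| ≤ R → |t - c (κ t)| ≤ R / (2 * n) := by
  have hn' : (0 : ℝ) < n := by exact_mod_cast hn
  refine ⟨fun t => ⟨min ⌊(t + R) * n / R⌋₊ (2 * n - 1), by omega⟩,
    fun i => -R + (2 * i.1 + 1) * (R / (2 * n)), fun t ht => ?_⟩
  obtain ⟨ht1, ht2⟩ := abs_le.1 ht
  set s := (t + R) * n / R with hs
  have hs0 : 0 ≤ s := div_nonneg (mul_nonneg (by linarith) hn'.le) hR.le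
  have hs2 : s ≤ 2 * n := by
    rw [hs, div_le_iff₀ hR]
    nlinarith
  have hts : t = -R + s * (R / n) := by rw [hs]; field_simp; ring
  have hfl := Nat.floor_le hs0
  have hlt := Nat.lt_floor_add_one s
  have key : |s - ((min ⌊s⌋₊ (2 * n - 1) : ℕ) : ℝ) - 1 / 2| ≤ 1 / 2 := by
    rcases le_total ⌊s⌋₊ (2 * n - 1) with hle | hle
    · rw [min_eq_left hle, abs_le]
      constructor <;> linarith
    · rw [min_eq_right hle, Nat.cast_sub (by omega), abs_le]
      have hle' : ((2 * n - 1 : ℕ) : ℝ) ≤ ⌊s⌋₊ := by exact_mod_cast hle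
      rw [Nat.cast_sub (by omega)] at hle'
      push_cast at hle' ⊢
      constructor <;> linarith
  have heq : t - (-R + (2 * ((min ⌊s⌋₊ (2 * n - 1) : ℕ) : ℝ) + 1) * (R / (2 * n))) =
      (s - ((min ⌊s⌋₊ (2 * n - 1) : ℕ) : ℝ) - 1 / 2) * (R / n) := by
    rw [hts]; field_simp; ring
  show |t - (-R + (2 * ((min ⌊s⌋₊ (2 * n - 1) : ℕ) : ℝ) + 1) * (R / (2 * n)))| ≤ _
  have hpos : 0 < R / n := by positivity
  rw [heq, abs_mul, abs_of_pos hpos]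
  calc _ ≤ 1 / 2 * (R / n) := by gcongr
    _ = _ := by field_simp

/-- Projections in a finite-dimensional star subalgebra can be enlarged to projections almost
commuting with a given selfadjoint element. -/
lemma exists_almost_commuting_projection_of_mem {B : StarSubalgebra ℂ A} [FiniteDimensional ℂ B]
    {b p : A} (hb : b ∈ B) (hbs : IsSelfAdjoint b) (hpB : p ∈ B) (hp : IsStarProjection p)
    {R : ℝ} (hR : 0 < R) (hbR : ‖b‖ ≤ R) {n : ℕ} (hn : 0 < n) :
    ∃ (q : A) (w : Fin (2 * n) → A), IsStarProjection q ∧ q * p = p ∧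
      ‖q * b - b * q‖ ≤ R / n ∧ ∑ i, star (w i) * w i = q ∧ ∀ i, p * w i = w i := by
  have hn' : (0 : ℝ) < n := by exact_mod_cast hn
  obtain ⟨κ, c, hκ⟩ := exists_cell_decomposition hR hn
  have hbf := finite_spectrum_of_mem hb
  have hpp := hp.isIdempotentElem.eq
  have hps := hp.isSelfAdjoint.star_eq
  set e : Fin (2 * n) → A := fun i => cfc (fun t => if κ t = i then (1 : ℝ) else 0) b with he
  have heP : ∀ i, IsStarProjection (e i) := fun i => isStarProjection_cfc_ite hbf _
  have hes : ∀ i, star (e i) = e i := fun i => (heP i).isSelfAdjoint.star_eq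
  have hee : ∀ i, e i * e i = e i := fun i => (heP i).isIdempotentElem.eq
  have heB : ∀ i, e i ∈ B := fun i => cfc_mem_of_finiteDimensional hb _
  have horth : ∀ i j, i ≠ j → e i * e j = 0 := by
    intro i j hij
    rw [he, ← cfc_mul _ _ _ (hbf.continuousOn _) (hbf.continuousOn _), ← cfc_zero ℝ b]
    refine cfc_congr fun t _ => ?_
    by_cases h : κ t = i
    · simp [h, hij]
    · simp [h]
  have hsum : ∑ i, e i = 1 := by
    rw [he, ← cfc_sum_univ _ _ fun i => hbf.continuousOn _, ← cfc_one ℝ b]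
    refine cfc_congr fun t _ => ?_
    simp [Finset.sum_apply]
  have happrox : ‖b - ∑ i, c i • e i‖ ≤ R / (2 * n) := by
    have h1 : ∑ i, c i • e i = cfc (fun t => c (κ t)) b := by
      have h2 : ∀ i, c i • e i = cfc (fun t => c i * if κ t = i then (1 : ℝ) else 0) b :=
        fun i => (cfc_const_mul _ _ _ (hbf.continuousOn _)).symm
      simp_rw [h2]
      rw [← cfc_sum_univ _ _ fun i => hbf.continuousOn _]
      refine cfc_congr fun t _ => ?_
      simp [Finset.sum_apply]
    rw [h1]
    conv_lhs => enter [1, 1]; rw [← cfc_id' ℝ b]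
    rw [← cfc_sub _ _ _ (hbf.continuousOn _) (hbf.continuousOn _)]
    refine norm_cfc_le (by positivity) fun t ht => hκ t ?_
    have : Nontrivial A := by
      by_contra hA
      rw [not_nontrivial_iff_subsingleton] at hA
      simp at ht
    exact (spectrum.norm_le_norm_of_mem ht).trans hbR
  have hsupp : ∀ i, ∃ r k l : A, IsStarProjection r ∧
      star (p * e i * k) * (p * e i * k) = r ∧ p * e i * r = p * e i ∧
      r = star (p * e i) * l := fun i =>
    exists_support_projection _ (finite_spectrum_of_mem (B := B)
      (mul_mem (star_mem (mul_mem hpB (heB i))) (mul_mem hpB (heB i))))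
  choose r k l hr hrk hpr hrl using hsupp
  have hrs : ∀ i, star (r i) = r i := fun i => (hr i).isSelfAdjoint.star_eq
  have her : ∀ i, e i * r i = r i := fun i => by
    rw [hrl i, star_mul, hes, ← mul_assoc, ← mul_assoc, hee]
  have hre : ∀ i, r i * e i = r i := fun i => by
    simpa only [star_mul, hes, hrs] using congrArg star (her i)
  have her0 : ∀ i j, i ≠ j → e i * r j = 0 := fun i j hij => by
    rw [← her j, ← mul_assoc, horth i j hij, zero_mul]
  have hre0 : ∀ i j, i ≠ j → r j * e i = 0 := fun i j hij => by
    rw [← hre j, mul_assoc, horth j i hij.symm, mul_zero]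
  have hrr0 : ∀ i j, i ≠ j → r i * r j = 0 := fun i j hij => by
    rw [← hre i, mul_assoc, her0 i j hij, mul_zero]
  have hrep : ∀ i, r i * p = e i * p := fun i => by
    have h1 : r i * (e i * p) = e i * p := by
      simpa only [star_mul, hes, hrs, hps] using congrArg star (hpr i)
    rw [← mul_assoc, hre] at h1
    exact h1
  set q := ∑ i, r i with hq
  have heq : ∀ i, e i * q = r i := fun i => by
    rw [hq, Finset.mul_sum, Finset.sum_eq_single i (fun j _ hj => her0 i j hj.symm) (by simp), her]
  have hqe : ∀ i, q * e i = r i := fun i => by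
    rw [hq, Finset.sum_mul, Finset.sum_eq_single i (fun j _ hj => hre0 i j hj.symm) (by simp), hre]
  have hqP : IsStarProjection q := by
    refine ⟨?_, ?_⟩
    · show q * q = q
      nth_rw 1 [hq]
      rw [Finset.sum_mul, hq]
      refine Finset.sum_congr rfl fun i _ => ?_
      rw [Finset.mul_sum, Finset.sum_eq_single i (fun j _ hj => hrr0 i j hj.symm) (by simp)]
      exact (hr i).isIdempotentElem.eq
    · show star q = q
      rw [hq, star_sum]
      exact Finset.sum_congr rfl fun i _ => hrs i
  refine ⟨q, fun i => p * e i * k i, hqP, ?_, ?_, ?_, fun i => ?_⟩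
  · rw [hq, Finset.sum_mul]
    simp_rw [hrep]
    rw [← Finset.sum_mul, hsum, one_mul]
  · set d := ∑ i, c i • e i with hd
    have hqd : q * d = d * q := by
      rw [hd, Finset.mul_sum, Finset.sum_mul]
      simp [heq, hqe]
    have h1 : q * b - b * q = q * (b - d) - (b - d) * q := by
      rw [mul_sub, sub_mul, hqd]; abel
    have hq1 : ‖q‖ ≤ 1 := IsStarProjection.norm_le q hqP
    rw [h1]
    calc _ ≤ ‖q‖ * ‖b - d‖ + ‖b - d‖ * ‖q‖ :=
          (norm_sub_le _ _).trans (add_le_add (norm_mul_le _ _) (norm_mul_le _ _))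
      _ ≤ 1 * (R / (2 * n)) + (R / (2 * n)) * 1 := by gcongr
      _ = R / n := by field_simp; ring
  · rw [hq]
    exact Finset.sum_congr rfl fun i _ => hrk i
  · simp only [← mul_assoc, hpp]

/-- In an AF algebra, every finite stage can be prolonged to one containing a selfadjoint element
close to a given one. -/
lemma exists_selfAdjoint_mem_norm_sub_lt {B : ℕ → StarSubalgebra ℂ A} (hmono : Monotone B)
    (hdense : Dense (⋃ k, (B k : Set A))) {a : A} (ha : IsSelfAdjoint a) (k : ℕ) {δ : ℝ}
    (hδ : 0 < δ) : ∃ m, k ≤ m ∧ ∃ b ∈ B m, IsSelfAdjoint b ∧ ‖a - b‖ < δ := by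
  obtain ⟨x, hx, hxa⟩ := Metric.dense_iff.1 hdense a δ hδ
  obtain ⟨m, hm⟩ := Set.mem_iUnion.1 hxa
  rw [Metric.mem_ball, dist_eq_norm] at hx
  have hxB : x ∈ B (max k m) := hmono (le_max_right _ _) hm
  refine ⟨max k m, le_max_left _ _, (realPart x : A), ?_, (realPart x).2, ?_⟩
  · rw [realPart_apply_coe]
    have : (2⁻¹ : ℝ) • (x + star x) = (2⁻¹ : ℂ) • (x + star x) := by
      rw [← Complex.coe_smul]; simp
    rw [this]
    exact SMulMemClass.smul_mem _ (add_mem hxB (star_mem hxB))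
  · have h1 : a - (realPart x : A) = ((realPart (a - x) : selfAdjoint A) : A) := by
      rw [map_sub, AddSubgroupClass.coe_sub, ha.coe_realPart]
    rw [h1]
    calc _ ≤ ‖a - x‖ := realPart.norm_le _
      _ < δ := by rwa [norm_sub_rev]

/-- Some finite stage of an AF algebra contains a projection at distance less than one from `p`. -/
lemma exists_projection_mem_norm_sub_lt_one {B : ℕ → StarSubalgebra ℂ A} (hmono : Monotone B)
    (hfin : ∀ k, FiniteDimensional ℂ (B k)) (hdense : Dense (⋃ k, (B k : Set A))) {p : A}
    (hp : IsStarProjection p) : ∃ k, ∃ p' ∈ B k, IsStarProjection p' ∧ ‖p - p'‖ < 1 := by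
  obtain ⟨k, -, b, hb, hbs, hpb⟩ :=
    exists_selfAdjoint_mem_norm_sub_lt hmono hdense hp.isSelfAdjoint 0
      (by norm_num : (0 : ℝ) < 1 / 20)
  have hbf := finite_spectrum_of_mem hb
  have hpp := hp.isIdempotentElem.eq
  refine ⟨k, _, cfc_mem_of_finiteDimensional hb (fun t => if 1 / 2 < t then 1 else 0),
    isStarProjection_cfc_ite hbf _, ?_⟩
  have hp1 : ‖p‖ ≤ 1 := IsStarProjection.norm_le p hp
  have hb1 : ‖b‖ ≤ 21 / 20 := by
    have := norm_le_norm_add_norm_sub p b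
    linarith
  have hbb : ‖b * b - b‖ ≤ 3 / 16 := by
    have h1 : b * b - b = -(b * (p - b)) - (p - b) * p + (p - b) := by
      calc _ = -(b * (p - b)) - (p * p - b * p) + (p * p - b) := by noncomm_ring
        _ = _ := by rw [hpp]; nth_rw 2 [← hpp]; noncomm_ring
    rw [h1]
    calc _ ≤ ‖b * (p - b)‖ + ‖(p - b) * p‖ + ‖p - b‖ := by
          refine (norm_add_le _ _).trans ?_
          gcongr
          refine (norm_sub_le _ _).trans ?_
          rw [norm_neg]
      _ ≤ ‖b‖ * ‖p - b‖ + ‖p - b‖ * ‖p‖ + ‖p - b‖ := by gcongr <;> exact norm_mul_le _ _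
      _ ≤ 21 / 20 * (1 / 20) + 1 / 20 * 1 + 1 / 20 := by gcongr
      _ ≤ _ := by norm_num
  have hspec : ∀ t ∈ spectrum ℝ b, |t * t - t| ≤ 3 / 16 := by
    have h1 : b * b - b = cfc (fun t : ℝ => t * t - t) b := by
      rw [cfc_sub _ _ _ (hbf.continuousOn _) (hbf.continuousOn _),
        cfc_mul _ _ _ (hbf.continuousOn _) (hbf.continuousOn _), cfc_id' ℝ b]
    rw [h1] at hbb
    exact (norm_cfc_le_iff _ b (by norm_num) (hbf.continuousOn _)).1 hbb
  have hdiff : ‖b - cfc (fun t : ℝ => if 1 / 2 < t then (1 : ℝ) else 0) b‖ ≤ 1 / 4 := by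
    conv_lhs => enter [1, 1]; rw [← cfc_id' ℝ b]
    rw [← cfc_sub _ _ _ (hbf.continuousOn _) (hbf.continuousOn _)]
    refine norm_cfc_le (by norm_num) fun t ht => ?_
    obtain ⟨h1, h2⟩ := abs_le.1 (hspec t ht)
    rw [Real.norm_eq_abs, abs_le]
    split_ifs with h
    · constructor <;> nlinarith
    · constructor <;> nlinarith
  have := norm_sub_le_norm_sub_add_norm_sub p b
    (cfc (fun t : ℝ => if 1 / 2 < t then (1 : ℝ) else 0) b)
  linarith

/-- The column matrix built from `w` implements the Murray–von Neumann subequivalence. -/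
lemma exists_column_matrix {N : ℕ} {p q : A} (hp : IsSelfAdjoint p) (w : Fin N → A)
    (hw : ∑ i, star (w i) * w i = q) (hpw : ∀ i, p * w i = w i) :
    ∃ v : Matrix (Fin N) (Fin N) A,
      (∀ i j, (vᴴ * v) i j = if i.1 = 0 ∧ j.1 = 0 then q else 0) ∧
      (v * vᴴ) * Matrix.diagonal (fun _ => p) = v * vᴴ := by
  refine ⟨Matrix.of fun i j => if j.1 = 0 then w i else 0, fun i j => ?_, ?_⟩
  · rw [Matrix.mul_apply]
    by_cases hi : i.1 = 0 <;> by_cases hj : j.1 = 0 <;>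
      simp [Matrix.conjTranspose_apply, hi, hj, hw]
  · have hwp : ∀ i, star (w i) * p = star (w i) := fun i => by
      simpa only [star_mul, hp.star_eq] using congrArg star (hpw i)
    rw [mul_assoc]
    congr 1
    ext i j
    rw [Matrix.mul_diagonal, Matrix.conjTranspose_apply, Matrix.of_apply]
    split_ifs
    · exact hwp j
    · simp

end Helpers

/-- Let `A` be a unital AF algebra, `a ∈ A` a nonzero selfadjoint element,
`p ∈ A` a projection, `ε > 0`, and `n ∈ ℕ` with `n > 1/ε`.  Then there is a projection
`q ∈ A` with `p ≤ q` (i.e. `q * p = p`), `‖q a - a q‖ < ε ‖a‖`, and `q` Murray–von Neumann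
subequivalent to the direct sum of `2n` copies of `p`: there is `v ∈ M_{2n}(A)` with
`v* v` the matrix having `q` in the `(0,0)` entry and `0` elsewhere, and `v v*` a
subprojection of `diag(p, …, p)`. -/
theorem stmt_3 {A : Type*} [CStarAlgebra A] (hA : IsAFAlgebra A)
    (a : A) (ha : IsSelfAdjoint a) (ha0 : a ≠ 0)
    (p : A) (hp_sa : IsSelfAdjoint p) (hp_idem : p * p = p)
    (ε : ℝ) (hε : 0 < ε) (n : ℕ) (hn : (n : ℝ) > 1 / ε) :
    ∃ q : A, IsSelfAdjoint q ∧ q * q = q ∧ q * p = p ∧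
      ‖q * a - a * q‖ < ε * ‖a‖ ∧
      ∃ v : Matrix (Fin (2 * n)) (Fin (2 * n)) A,
        (∀ i j, (vᴴ * v) i j = if i.1 = 0 ∧ j.1 = 0 then q else 0) ∧
        (v * vᴴ) * Matrix.diagonal (fun _ => p) = v * vᴴ := by
  obtain ⟨B, hmono, hfin, hdense⟩ := hA
  have hp : IsStarProjection p := ⟨hp_idem, hp_sa⟩
  have hnpos : (0 : ℝ) < n := lt_trans (by positivity) hn
  have hn0 : 0 < n := by exact_mod_cast hnpos
  have hn1 : (1 : ℝ) ≤ n := by exact_mod_cast hn0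
  have haN : 0 < ‖a‖ := norm_pos_iff.2 ha0
  have hgap : 0 < ε * ‖a‖ - ‖a‖ / n := by
    have h1 : 1 / (n : ℝ) < ε := by
      rw [gt_iff_lt, div_lt_iff₀ hε] at hn
      rwa [div_lt_iff₀ hnpos, mul_comm]
    have h2 : 1 / (n : ℝ) * ‖a‖ < ε * ‖a‖ := by gcongr
    have h3 : 1 / (n : ℝ) * ‖a‖ = ‖a‖ / n := by ring
    linarith
  set δ := (ε * ‖a‖ - ‖a‖ / n) / 4 with hδ
  have hδ0 : 0 < δ := by positivity
  obtain ⟨k, p', hp'B, hp', hpp'⟩ := exists_projection_mem_norm_sub_lt_one hmono hfin hdense hp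
  obtain ⟨u, hu, hup⟩ := exists_unitary_conj_of_norm_sub_lt_one hp hp' hpp'
  obtain ⟨hu1, hu2⟩ := Unitary.mem_iff.1 hu
  obtain ⟨m, hkm, b, hbB, hbs, hab⟩ :=
    exists_selfAdjoint_mem_norm_sub_lt hmono hdense (ha.conjugate' u) k hδ0
  have huN : ‖star u * a * u‖ = ‖a‖ := by
    rw [CStarRing.norm_mul_mem_unitary _ hu,
      CStarRing.norm_mem_unitary_mul _ (Unitary.star_mem hu)]
  have hbN : ‖b‖ ≤ ‖a‖ + δ := by
    have := norm_le_norm_add_norm_sub (star u * a * u) b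
    rw [huN] at this
    linarith
  obtain ⟨q, w, hq, hqp, hqb, hwq, hpw⟩ := exists_almost_commuting_projection_of_mem
    (B := B m) hbB hbs (hmono hkm hp'B) hp' (by positivity) hbN hn0
  have hqq := hq.isIdempotentElem.eq
  have hqN : ‖q‖ ≤ 1 := IsStarProjection.norm_le q hq
  have hpu : star u * p = p' * star u := by
    calc star u * p = star u * p * (u * star u) := by rw [hu2, mul_one]
      _ = star u * (p * u) * star u := by noncomm_ring
      _ = (star u * u) * p' * star u := by rw [← hup]; noncomm_ring
      _ = p' * star u := by rw [hu1, one_mul]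
  refine ⟨u * q * star u, hq.isSelfAdjoint.conjugate u, ?_, ?_, ?_, ?_⟩
  · calc _ = u * q * (star u * u) * q * star u := by noncomm_ring
      _ = u * (q * q) * star u := by rw [hu1]; noncomm_ring
      _ = _ := by rw [hqq]
  · rw [mul_assoc, hpu]
    calc _ = u * (q * p') * star u := by noncomm_ring
      _ = p * (u * star u) := by rw [hqp, hup, mul_assoc]
      _ = p := by rw [hu2, mul_one]
  · set a' := star u * a * u with ha'
    have h1 : u * q * star u * a - a * (u * q * star u) = u * (q * a' - a' * q) * star u := by
      calc _ = u * q * star u * a * 1 - 1 * a * (u * q * star u) := by simp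
        _ = u * q * star u * a * (u * star u) - (u * star u) * a * (u * q * star u) := by rw [hu2]
        _ = _ := by rw [ha']; noncomm_ring
    rw [h1, CStarRing.norm_mul_mem_unitary _ (Unitary.star_mem hu),
      CStarRing.norm_mem_unitary_mul _ hu]
    have h2 : q * a' - a' * q = (q * b - b * q) + (q * (a' - b) - (a' - b) * q) := by
      noncomm_ring
    have h3 : (‖a‖ + δ) / n ≤ ‖a‖ / n + δ := by
      rw [add_div]
      gcongr
      exact div_le_self hδ0.le hn1
    rw [h2]
    calc _ ≤ ‖q * b - b * q‖ + (‖q‖ * ‖a' - b‖ + ‖a' - b‖ * ‖q‖) :=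
          (norm_add_le _ _).trans (add_le_add le_rfl ((norm_sub_le _ _).trans
            (add_le_add (norm_mul_le _ _) (norm_mul_le _ _))))
      _ ≤ (‖a‖ + δ) / n + (1 * δ + δ * 1) := by gcongr
      _ < ε * ‖a‖ := by linarith
  · refine exists_column_matrix hp_sa (fun i => u * w i * star u) ?_ fun i => ?_
    · rw [← hwq, Finset.mul_sum, Finset.sum_mul]
      refine Finset.sum_congr rfl fun i _ => ?_
      simp only [star_mul, star_star]
      calc _ = u * star (w i) * (star u * u) * w i * star u := by noncomm_ring
        _ = _ := by rw [hu1]; noncomm_ring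
    · calc _ = (p * u) * w i * star u := by noncomm_ring
        _ = u * (p' * w i) * star u := by rw [← hup]; noncomm_ring
        _ = _ := by rw [hpw]
end

section
/- Let A be a unital AF algebra, let a, b ∈ A be positive elements with ‖a‖ ≤ 1, ‖b‖ ≤ 1, and a b = b, and let ε > 0. Then there exists a projection p in the hereditary subalgebra generated by b, i.e. p lies in the norm closure of {b x b : x ∈ A}, such that a p = p and ‖p b − b‖ < ε. -/
/-- An element integral over `ℂ` has finite real spectrum. -/
theorem IsIntegral.finite_spectrum_real {A : Type*} [CStarAlgebra A] {c : A}
    (hc : IsIntegral ℂ c) : (spectrum ℝ c).Finite := by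
  obtain ⟨P, hP, hPc⟩ := hc
  have hfin : (spectrum ℂ c).Finite := by
    refine (P.rootSet_finite ℂ).subset fun z hz => ?_
    have hmem := spectrum.subset_polynomial_aeval c P ⟨z, hz, rfl⟩
    have h0 : Polynomial.aeval c P = 0 := hPc
    rw [h0] at hmem
    have : Nontrivial A := by
      by_contra hA
      rw [not_nontrivial_iff_subsingleton] at hA
      exact hz (isUnit_of_subsingleton _)
    rw [spectrum.zero_eq] at hmem
    rw [Polynomial.mem_rootSet]
    exact ⟨hP.ne_zero, by simpa using hmem⟩
  rw [← spectrum.preimage_algebraMap ℂ]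
  exact hfin.preimage (FaithfulSMul.algebraMap_injective ℝ ℂ).injOn

/-- In an AF algebra the selfadjoint elements with finite spectrum are dense among the
selfadjoint elements. -/
theorem IsAFAlgebra.exists_isSelfAdjoint_finite_spectrum {A : Type*} [CStarAlgebra A]
    (hA : IsAFAlgebra A) {b : A} (hb : IsSelfAdjoint b) {δ : ℝ} (hδ : 0 < δ) :
    ∃ c : A, IsSelfAdjoint c ∧ (spectrum ℝ c).Finite ∧ ‖b - c‖ < δ := by
  obtain ⟨B, -, hfin, hdense⟩ := hA
  obtain ⟨d, hd, hbd⟩ := hdense.exists_dist_lt b hδ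
  obtain ⟨k, hk⟩ := Set.mem_iUnion.mp hd
  have hcB : (realPart d : A) ∈ B k := by
    rw [realPart_apply_coe, ← Complex.coe_smul]
    exact (B k).smul_mem (add_mem hk (star_mem hk)) _
  refine ⟨realPart d, (realPart d).2, IsIntegral.finite_spectrum_real ?_, ?_⟩
  · have := hfin k
    exact (Algebra.IsIntegral.isIntegral (R := ℂ) (⟨_, hcB⟩ : B k)).map (B k).subtype
  · have h : b - realPart d = (realPart (b - d) : A) := by
      simp [hb.coe_realPart]
    rw [h]
    rw [dist_eq_norm] at hbd
    exact (realPart.norm_le (b - d)).trans_lt hbd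

/-- For a selfadjoint `c` with finite spectrum, the spectral projection `q` of `c` for
`{t | η ≤ |t|}` together with the inverse `g` of `c` on the range of `q`. -/
theorem IsSelfAdjoint.exists_spectral_cutoff {A : Type*} [CStarAlgebra A] {c : A}
    (hc : IsSelfAdjoint c) (hfin : (spectrum ℝ c).Finite) {η : ℝ} (hη : 0 < η) :
    ∃ q g : A, IsStarProjection q ∧ IsSelfAdjoint g ∧ g * c = q ∧ q * g = g ∧
      ‖g‖ ≤ η⁻¹ ∧ ‖(1 - q) * c‖ ≤ η := by
  classical
  have hcont (f : ℝ → ℝ) : ContinuousOn f (spectrum ℝ c) := hfin.continuousOn f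
  let f : ℝ → ℝ := fun t => if η ≤ |t| then 1 else 0
  let h : ℝ → ℝ := fun t => if η ≤ |t| then t⁻¹ else 0
  have hmul (u v : ℝ → ℝ) : cfc u c * cfc v c = cfc (fun t => u t * v t) c :=
    (cfc_mul u v c (hcont u) (hcont v)).symm
  have hid : cfc (fun t : ℝ => t) c = c := cfc_id' ℝ c
  have hone : cfc (fun _ : ℝ => (1 : ℝ)) c = 1 := cfc_const_one ℝ c
  refine ⟨cfc f c, cfc h c, ⟨?_, cfc_predicate f c⟩, cfc_predicate h c, ?_, ?_, ?_, ?_⟩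
  · rw [IsIdempotentElem, hmul]
    congr 1; ext t; simp [f]
  · calc cfc h c * c = cfc h c * cfc (fun t : ℝ => t) c := by rw [hid]
      _ = cfc f c := by
        rw [hmul]
        congr 1; ext t
        by_cases ht : η ≤ |t|
        · have : t ≠ 0 := abs_pos.mp (hη.trans_le ht)
          simp [f, h, ht, this]
        · simp [f, h, ht]
  · rw [hmul]
    congr 1; ext t; by_cases ht : η ≤ |t| <;> simp [f, h, ht]
  · refine norm_cfc_le (by positivity) fun t _ => ?_
    by_cases ht : η ≤ |t|
    · simp only [h, ht, if_true, norm_inv, Real.norm_eq_abs]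
      gcongr
    · simp only [h, ht, if_false, norm_zero]
      positivity
  · have heq : (1 - cfc f c) * c = cfc (fun t => (1 - f t) * t) c := by
      rw [← hmul, cfc_sub _ _ c (hcont _) (hcont _), hid, hone]
    rw [heq]
    refine norm_cfc_le hη.le fun t _ => ?_
    by_cases ht : η ≤ |t|
    · simp [f, ht, hη.le]
    · simpa [f, ht] using (not_le.mp ht).le

/-- If `v` is close to a projection `q` and `q * v = v`, then `star v` has a range projection of
the form `star v * z * v`. -/
theorem IsStarProjection.exists_range_projection {A : Type*} [CStarAlgebra A] {q v : A}
    (hq : IsStarProjection q) (hqv : q * v = v) (hv : ‖v - q‖ ≤ 1 / 4) :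
    ∃ z : A, IsStarProjection (star v * z * v) ∧ star v * z * v * star v = star v := by
  have hqs : star q = q := hq.isSelfAdjoint
  have hqq : q * q = q := hq.isIdempotentElem
  have hvq : star v * q = star v := by simpa [hqs] using congrArg star hqv
  have hqn : ‖q‖ ≤ 1 := hq.norm_le
  have hvn : ‖star v‖ ≤ 5 / 4 := by
    rw [norm_star]
    calc ‖v‖ = ‖(v - q) + q‖ := by simp
      _ ≤ ‖v - q‖ + ‖q‖ := norm_add_le _ _
      _ ≤ 5 / 4 := by linarith
  have hsv : ‖star v - q‖ ≤ 1 / 4 := by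
    rw [← norm_star]; simpa [hqs] using hv
  have hlt : ‖q - v * star v‖ < 1 := by
    calc ‖q - v * star v‖ = ‖(v - q) * star v + q * (star v - q)‖ := by
          rw [← norm_neg]; congr 1; rw [sub_mul, mul_sub, hqq]; abel
      _ ≤ ‖v - q‖ * ‖star v‖ + ‖q‖ * ‖star v - q‖ :=
          (norm_add_le _ _).trans (add_le_add (norm_mul_le _ _) (norm_mul_le _ _))
      _ ≤ 1 / 4 * (5 / 4) + 1 * (1 / 4) := by gcongr
      _ < 1 := by norm_num
  let y : Aˣ := Units.oneSub (q - v * star v) hlt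
  have hy : (y : A) = 1 - (q - v * star v) := rfl
  have hyq : (y : A) * q = v * star v := by
    rw [hy, sub_mul, sub_mul, one_mul, hqq, mul_assoc, hvq]; abel
  have hys : star y = y := by
    ext; simp [hy, hqs]
  have hzs : star ((y⁻¹ : Aˣ) : A) = (y⁻¹ : Aˣ) := by
    rw [← Units.coe_star, star_inv, hys]
  have habs : star v * (y⁻¹ : Aˣ) * v * star v = star v := by
    rw [mul_assoc _ v, ← hyq, mul_assoc, Units.inv_mul_cancel_left, hvq]
  refine ⟨(y⁻¹ : Aˣ), ⟨?_, ?_⟩, habs⟩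
  · rw [IsIdempotentElem]
    simp only [← mul_assoc]
    rw [habs]
  · rw [IsSelfAdjoint]
    simp [hzs, mul_assoc]

/-- Let `A` be a unital AF algebra, let `a, b ∈ A` be positive with
`‖a‖ ≤ 1`, `‖b‖ ≤ 1`, and `a b = b`, and let `ε > 0`.  Then there is a projection `p`
in the hereditary subalgebra generated by `b` (the norm closure of `{b x b : x ∈ A}`)
such that `a p = p` and `‖p b - b‖ < ε`. -/
theorem stmt_4 {A : Type*} [CStarAlgebra A] [PartialOrder A] [StarOrderedRing A]
    (hA : IsAFAlgebra A)
    (a b : A) (ha : 0 ≤ a) (hb : 0 ≤ b) (hna : ‖a‖ ≤ 1) (hnb : ‖b‖ ≤ 1)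
    (hab : a * b = b) (ε : ℝ) (hε : 0 < ε) :
    ∃ p ∈ closure {y : A | ∃ x : A, y = b * x * b},
      IsSelfAdjoint p ∧ p * p = p ∧ a * p = p ∧ ‖p * b - b‖ < ε := by
  have hbs : IsSelfAdjoint b := .of_nonneg hb
  obtain ⟨r, hr0, hr1, hrε⟩ : ∃ r : ℝ, 0 < r ∧ r ≤ 1 / 4 ∧ r ≤ ε / 4 :=
    ⟨min (1 / 4) (ε / 4), by positivity, min_le_left _ _, min_le_right _ _⟩
  obtain ⟨c, hc, hfin, hbc⟩ :=
    hA.exists_isSelfAdjoint_finite_spectrum hbs (show 0 < ε / 4 * r by positivity)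
  obtain ⟨q, g, hq, hg, hgc, hqg, hgn, hqc⟩ :=
    hc.exists_spectral_cutoff hfin (show 0 < ε / 4 by positivity)
  have hvq : ‖g * b - q‖ ≤ r := by
    calc ‖g * b - q‖ = ‖g * (b - c)‖ := by rw [mul_sub, hgc]
      _ ≤ ‖g‖ * ‖b - c‖ := norm_mul_le _ _
      _ ≤ (ε / 4)⁻¹ * (ε / 4 * r) := by gcongr
      _ = r := by field_simp
  obtain ⟨z, hp, hpv⟩ := hq.exists_range_projection (v := g * b)
    (by rw [← mul_assoc, hqg]) (hvq.trans hr1)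
  have hv : star (g * b) = b * g := by rw [star_mul, hbs.star_eq, hg.star_eq]
  rw [hv] at hp hpv
  set p := b * g * z * (g * b) with hpdef
  refine ⟨p, subset_closure ⟨g * z * g, by simp only [hpdef, mul_assoc]⟩, hp.isSelfAdjoint,
    hp.isIdempotentElem, by simp only [hpdef, ← mul_assoc, hab], ?_⟩
  have hqb : ‖q - b * g‖ ≤ r := by
    rw [← norm_star, ← norm_neg]
    simpa [hbs.star_eq, hg.star_eq, hq.isSelfAdjoint.star_eq] using hvq
  have hpn : ‖1 - p‖ ≤ 1 := hp.one_sub.norm_le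
  have hqn : ‖1 - q‖ ≤ 1 := hq.one_sub.norm_le
  have hsplit : b - p * b =
      (1 - p) * ((q - b * g) * b + ((1 - q) * c + (1 - q) * (b - c))) := by
    have hpbg : (1 - p) * (b * g) = 0 := by
      rw [sub_mul, one_mul, ← mul_assoc p, mul_assoc, ← mul_assoc p, sub_eq_zero]
      simpa only [mul_assoc] using hpv.symm
    have hinner : (q - b * g) * b + ((1 - q) * c + (1 - q) * (b - c)) = b - b * g * b := by
      noncomm_ring
    rw [hinner, mul_sub, ← mul_assoc (1 - p), hpbg, zero_mul, sub_zero, sub_mul, one_mul]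
  rw [norm_sub_rev, hsplit]
  calc _ ≤ ‖1 - p‖ * (‖q - b * g‖ * ‖b‖ + (‖(1 - q) * c‖ + ‖1 - q‖ * ‖b - c‖)) := by
        refine (norm_mul_le _ _).trans (mul_le_mul_of_nonneg_left ?_ (norm_nonneg _))
        refine (norm_add_le _ _).trans (add_le_add (norm_mul_le _ _) ?_)
        exact (norm_add_le _ _).trans (add_le_add le_rfl (norm_mul_le _ _))
    _ ≤ 1 * (r * 1 + (ε / 4 + 1 * (ε / 4 * r))) := by gcongr
    _ < ε := by nlinarith
end

section
/- Let r > 0, let f₁, f₂, …, fₙ : [−r, r] → [0, 1] be continuous functions, and let ε > 0. Then there exists δ > 0 with the following property: whenever A is a unital C*-algebra, p ∈ A is a projection, and a ∈ A is a selfadjoint element with ‖a‖ ≤ r and ‖p a − a p‖ < δ, such that τ(f_k(a)) − τ(1 − p) > ε for all 1 ≤ k ≤ n and all normalized traces τ on A, then τ(p · f_k(p a p) · p) > τ(f_k(a)) − τ(1 − p) − ε for all 1 ≤ k ≤ n and all normalized traces τ on A. -/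
open scoped ComplexOrder

/-- A normalized trace on a unital C*-algebra `A`: a complex-linear functional `τ` with
`τ 1 = 1`, `τ(a* a) ≥ 0` (i.e. a nonnegative real number, in the complex order) for all
`a`, and `τ(a b) = τ(b a)` for all `a, b`. -/
def IsNormalizedTrace {A : Type*} [CStarAlgebra A] (τ : A →ₗ[ℂ] ℂ) : Prop :=
  τ 1 = 1 ∧ (∀ a : A, 0 ≤ τ (star a * a)) ∧ ∀ a b : A, τ (a * b) = τ (b * a)

open Polynomial

namespace IsNormalizedTrace

variable {A : Type*} [CStarAlgebra A] {τ : A →ₗ[ℂ] ℂ}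

/-- A normalized trace is nonnegative on `q * g(a) * q` when `q` is selfadjoint and `g` is
nonnegative on the spectrum of `a`. -/
lemma conj_cfc_nonneg (hτ : IsNormalizedTrace τ) {a : A} (g : ℝ → ℝ)
    (hg : ∀ x ∈ spectrum ℝ a, 0 ≤ g x) {q : A} (hq : IsSelfAdjoint q) :
    0 ≤ τ (q * cfc g a * q) := by
  let _ := CStarAlgebra.spectralOrder A
  let _ := CStarAlgebra.spectralOrderedRing A
  obtain ⟨y, hy⟩ := CStarAlgebra.nonneg_iff_eq_star_mul_self.mp (cfc_nonneg hg)
  have h := hτ.2.1 (y * q)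
  rwa [star_mul, hq.star_eq, mul_assoc, ← mul_assoc (star y), ← hy, ← mul_assoc] at h

/-- A normalized trace of a selfadjoint element is at least minus its norm. -/
lemma nonneg_add_norm (hτ : IsNormalizedTrace τ) {x : A} (hx : IsSelfAdjoint x) :
    0 ≤ τ x + (‖x‖ : ℂ) := by
  let _ := CStarAlgebra.spectralOrder A
  let _ := CStarAlgebra.spectralOrderedRing A
  have hpos : 0 ≤ x + algebraMap ℝ A ‖x‖ := by
    simpa [neg_le_iff_add_nonneg] using hx.neg_algebraMap_norm_le_self
  obtain ⟨y, hy⟩ := CStarAlgebra.nonneg_iff_eq_star_mul_self.mp hpos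
  have h := hτ.2.1 y
  rw [← hy, map_add, Algebra.algebraMap_eq_smul_one, ← Complex.coe_smul, map_smul, hτ.1] at h
  simpa using h

/-- Compressing by a projection `p` loses at most `τ (1 - p)` of the trace of a contraction. -/
lemma cfc_sub_le_conj (hτ : IsNormalizedTrace τ) {p a : A} (hp : IsSelfAdjoint p)
    (hpp : p * p = p) (ha : IsSelfAdjoint a) {g : ℝ → ℝ} (hg : ContinuousOn g (spectrum ℝ a))
    (hg1 : ∀ x ∈ spectrum ℝ a, g x ≤ 1) :
    τ (cfc g a) - τ (1 - p) ≤ τ (p * cfc g a * p) := by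
  have h := hτ.conj_cfc_nonneg (a := a) (fun x ↦ 1 - g x) (fun x hx ↦ sub_nonneg.2 (hg1 x hx))
    ((IsSelfAdjoint.one A).sub hp)
  rw [cfc_sub (fun _ ↦ (1 : ℝ)) g a, cfc_const_one ℝ a] at h
  have hexp : (1 - p) * (1 - cfc g a) * (1 - p)
      = (1 - p) - cfc g a + p * cfc g a + cfc g a * p - p * cfc g a * p := by
    have : (1 - p) * (1 - cfc g a) * (1 - p)
      = (1 - p - p + p * p) - cfc g a + p * cfc g a + cfc g a * p - p * cfc g a * p := by
      noncomm_ring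
    rw [this, hpp]
    noncomm_ring
  have h₁ : τ (p * cfc g a * p) = τ (p * cfc g a) := by
    rw [hτ.2.2, ← mul_assoc, hpp]
  have h₂ : τ (cfc g a * p) = τ (p * cfc g a) := hτ.2.2 _ _
  rw [hexp] at h
  simp only [map_add, map_sub τ _ (p * _ * p), map_sub τ _ (cfc g a), h₁, h₂] at h ⊢
  rw [← sub_nonneg]
  convert h using 1
  ring

end IsNormalizedTrace

lemma norm_le_one_of_isSelfAdjoint_of_mul_self {A : Type*} [CStarAlgebra A] {p : A}
    (hp : IsSelfAdjoint p) (hpp : p * p = p) : ‖p‖ ≤ 1 :=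
  IsStarProjection.norm_le p ⟨hpp, hp⟩

lemma norm_conj_le_of_norm_le_one {A : Type*} [CStarAlgebra A] {p : A} (hp : ‖p‖ ≤ 1) (x : A) :
    ‖p * x * p‖ ≤ ‖x‖ := by
  calc ‖p * x * p‖ ≤ ‖p‖ * ‖x‖ * ‖p‖ := norm_mul₃_le
    _ ≤ 1 * ‖x‖ * 1 := by gcongr
    _ = ‖x‖ := by ring

universe u

/-- Polynomials intertwine an almost-commuting projection up to a multiple of the commutator,
uniformly over all C⋆-algebras and all elements of norm at most `r`. -/
lemma exists_norm_mul_aeval_sub_aeval_mul_le (r : ℝ) (hr : 0 ≤ r) (q : ℝ[X]) :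
    ∃ C ≥ 0, ∀ (A : Type u) [CStarAlgebra A], ∀ p a : A, ‖p‖ ≤ 1 → p * p = p → ‖a‖ ≤ r →
      ‖p * aeval a q - aeval (p * a * p) q * p‖ ≤ C * ‖p * a - a * p‖ := by
  induction q using Polynomial.induction_on with
  | C c =>
    refine ⟨0, le_rfl, fun A _ p a _ _ _ ↦ ?_⟩
    simp [Algebra.commutes]
  | add q₁ q₂ h₁ h₂ =>
    obtain ⟨C₁, hC₁, h₁⟩ := h₁
    obtain ⟨C₂, hC₂, h₂⟩ := h₂
    refine ⟨C₁ + C₂, by positivity, fun A _ p a hp hpp ha ↦ ?_⟩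
    have heq : p * aeval a (q₁ + q₂) - aeval (p * a * p) (q₁ + q₂) * p
        = (p * aeval a q₁ - aeval (p * a * p) q₁ * p)
          + (p * aeval a q₂ - aeval (p * a * p) q₂ * p) := by
      simp only [map_add]
      noncomm_ring
    rw [heq, add_mul]
    exact norm_add_le_of_le (h₁ A p a hp hpp ha) (h₂ A p a hp hpp ha)
  | monomial m c h =>
    obtain ⟨C, hC, h⟩ := h
    refine ⟨C * r + ‖c‖ * r ^ m, by positivity, fun A _ p a hp hpp ha ↦ ?_⟩
    rcases subsingleton_or_nontrivial A with _ | _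
    · rw [Subsingleton.elim (_ - _) (0 : A), norm_zero]
      positivity
    set b := p * a * p with hb
    have hbr : ‖b‖ ≤ r := (norm_conj_le_of_norm_le_one hp a).trans ha
    have hbp : b * p = b := by rw [hb, mul_assoc, hpp]
    have hpow (x : A) : aeval x (Polynomial.C c * X ^ (m + 1))
        = aeval x (Polynomial.C c * X ^ m) * x := by
      simp [pow_succ, mul_assoc]
    have heq : p * aeval a (Polynomial.C c * X ^ (m + 1))
          - aeval b (Polynomial.C c * X ^ (m + 1)) * p
        = (p * aeval a (Polynomial.C c * X ^ m) - aeval b (Polynomial.C c * X ^ m) * p) * a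
          + aeval b (Polynomial.C c * X ^ m) * (p * (p * a - a * p)) := by
      rw [hpow, hpow, mul_sub, ← mul_assoc p p a, hpp, ← mul_assoc p a p, ← hb, mul_assoc _ b p,
        hbp]
      noncomm_ring
    have hmon : ‖aeval b (Polynomial.C c * X ^ m)‖ ≤ ‖c‖ * r ^ m := by
      simp only [map_mul, aeval_C, map_pow, aeval_X]
      calc ‖algebraMap ℝ A c * b ^ m‖ ≤ ‖algebraMap ℝ A c‖ * ‖b ^ m‖ := norm_mul_le _ _
        _ ≤ ‖c‖ * r ^ m := by
          rw [norm_algebraMap']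
          gcongr
          exact (norm_pow_le b m).trans (by gcongr)
    rw [heq]
    calc _ ≤ C * ‖p * a - a * p‖ * r + ‖c‖ * r ^ m * (1 * ‖p * a - a * p‖) := by
          refine norm_add_le_of_le (norm_mul_le_of_le (h A p a hp hpp ha) ha)
            (norm_mul_le_of_le hmon (norm_mul_le_of_le hp le_rfl))
      _ = _ := by ring

lemma spectrum_subset_Icc_of_norm_le {A : Type*} [CStarAlgebra A] {a : A} {r : ℝ}
    (ha : ‖a‖ ≤ r) : spectrum ℝ a ⊆ Set.Icc (-r) r := by
  rcases subsingleton_or_nontrivial A with _ | _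
  · simp [spectrum.of_subsingleton]
  · intro x hx
    exact abs_le.1 ((spectrum.norm_le_norm_of_mem hx).trans ha)

lemma norm_cfc_sub_aeval_le {A : Type*} [CStarAlgebra A] {a : A} (ha : IsSelfAdjoint a)
    {g : ℝ → ℝ} (hg : ContinuousOn g (spectrum ℝ a)) {q : ℝ[X]} {η : ℝ} (hη : 0 ≤ η)
    (hq : ∀ x ∈ spectrum ℝ a, |q.eval x - g x| ≤ η) : ‖cfc g a - aeval a q‖ ≤ η := by
  rw [norm_sub_rev, ← cfc_polynomial q a, ← cfc_sub _ g a (by fun_prop) hg]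
  exact norm_cfc_le hη hq

/-- Compression by an almost-commuting projection almost commutes with the functional calculus. -/
lemma exists_norm_conj_cfc_sub_conj_cfc_lt (r : ℝ) (hr : 0 ≤ r) (g : ℝ → ℝ)
    (hg : ContinuousOn g (Set.Icc (-r) r)) (ε : ℝ) (hε : 0 < ε) :
    ∃ δ > 0, ∀ (A : Type u) [CStarAlgebra A], ∀ p a : A,
      IsSelfAdjoint p → p * p = p → IsSelfAdjoint a → ‖a‖ ≤ r → ‖p * a - a * p‖ < δ →
      ‖p * cfc g (p * a * p) * p - p * cfc g a * p‖ < ε := by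
  obtain ⟨q, hq⟩ := exists_polynomial_near_of_continuousOn (-r) r g hg (ε / 4) (by positivity)
  obtain ⟨C, hC, hCq⟩ := exists_norm_mul_aeval_sub_aeval_mul_le.{u} r hr q
  refine ⟨ε / 4 / (C + 1), by positivity, fun A _ p a hp hpp ha har hδ ↦ ?_⟩
  have hp1 := norm_le_one_of_isSelfAdjoint_of_mul_self hp hpp
  have hbsa : IsSelfAdjoint (p * a * p) := by simpa [hp.star_eq] using ha.conjugate p
  have hbr := (norm_conj_le_of_norm_le_one hp1 a).trans har
  have happrox {x : A} (hx : IsSelfAdjoint x) (hxr : ‖x‖ ≤ r) :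
      ‖cfc g x - aeval x q‖ ≤ ε / 4 :=
    norm_cfc_sub_aeval_le hx (hg.mono (spectrum_subset_Icc_of_norm_le hxr)) (by positivity)
      fun y hy ↦ (hq y (spectrum_subset_Icc_of_norm_le hxr hy)).le
  have hcomm : ‖p * aeval a q - aeval (p * a * p) q * p‖ ≤ ε / 4 := by
    refine (hCq A p a hp1 hpp har).trans ?_
    rw [lt_div_iff₀ (by positivity)] at hδ
    nlinarith [norm_nonneg (p * a - a * p)]
  have heq : p * cfc g (p * a * p) * p - p * cfc g a * p
      = p * (cfc g (p * a * p) - aeval (p * a * p) q) * p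
        - p * (p * aeval a q - aeval (p * a * p) q * p) * p
        - p * (cfc g a - aeval a q) * p := by
    have h₁ : p * (p * aeval a q - aeval (p * a * p) q * p) * p
        = p * aeval a q * p - p * aeval (p * a * p) q * p := by
      rw [mul_sub, sub_mul, ← mul_assoc p p, hpp, mul_assoc p (_ * p) p, mul_assoc _ p p, hpp,
        ← mul_assoc p _ p]
    rw [h₁]
    noncomm_ring
  rw [heq]
  have h₁ := norm_sub_le_of_le (norm_sub_le_of_le
    ((norm_conj_le_of_norm_le_one hp1 _).trans (happrox hbsa hbr))
    ((norm_conj_le_of_norm_le_one hp1 _).trans hcomm))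
    ((norm_conj_le_of_norm_le_one hp1 _).trans (happrox ha har))
  linarith

/-- Let `r > 0`, let `f₁, …, fₙ : [-r, r] → [0,1]` be continuous, and let
`ε > 0`.  Then there is `δ > 0` such that: whenever `A` is a unital C*-algebra,
`p ∈ A` is a projection, `a ∈ A` is selfadjoint with `‖a‖ ≤ r` and `‖pa - ap‖ < δ`,
and `τ(f_k(a)) - τ(1-p) > ε` for all `k` and all normalized traces `τ`, then
`τ(p f_k(pap) p) > τ(f_k(a)) - τ(1-p) - ε` for all `k` and all normalized traces `τ`.
(Here `f_k(·)` is the continuous functional calculus, and `p f_k(pap) p` computes the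
functional calculus of `f_k` at `pap` inside the corner `pAp`.) -/
theorem stmt_5 (r : ℝ) (hr : 0 < r) (n : ℕ) (f : Fin n → ℝ → ℝ)
    (hf_cont : ∀ k, ContinuousOn (f k) (Set.Icc (-r) r))
    (hf_maps : ∀ k, ∀ x ∈ Set.Icc (-r) r, f k x ∈ Set.Icc (0 : ℝ) 1)
    (ε : ℝ) (hε : 0 < ε) :
    ∃ δ > 0, ∀ (A : Type*) [CStarAlgebra A], ∀ p a : A,
      IsSelfAdjoint p → p * p = p → IsSelfAdjoint a → ‖a‖ ≤ r →
      ‖p * a - a * p‖ < δ →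
      (∀ (k : Fin n) (τ : A →ₗ[ℂ] ℂ), IsNormalizedTrace τ →
        (ε : ℂ) < τ (cfc (f k) a) - τ (1 - p)) →
      ∀ (k : Fin n) (τ : A →ₗ[ℂ] ℂ), IsNormalizedTrace τ →
        τ (cfc (f k) a) - τ (1 - p) - (ε : ℂ) < τ (p * cfc (f k) (p * a * p) * p) := by
  choose δ hδ hδf using fun k ↦
    exists_norm_conj_cfc_sub_conj_cfc_lt r hr.le (f k) (hf_cont k) ε hε
  obtain ⟨δ₀, hδ₀, hle⟩ : ∃ δ₀ > 0, ∀ k, δ₀ ≤ δ k := by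
    rcases isEmpty_or_nonempty (Fin n) with _ | _
    · exact ⟨1, one_pos, fun k ↦ isEmptyElim k⟩
    · obtain ⟨k₀, hk₀⟩ := Finite.exists_min δ
      exact ⟨δ k₀, hδ k₀, hk₀⟩
  refine ⟨δ₀, hδ₀, fun A _ p a hp hpp ha har hpa _ k τ hτ ↦ ?_⟩
  have hspec := spectrum_subset_Icc_of_norm_le har
  have hlt := hδf k A p a hp hpp ha har (hpa.trans_le (hle k))
  have hsa (x : A) : IsSelfAdjoint (p * cfc (f k) x * p) := by
    simpa [hp.star_eq] using (IsSelfAdjoint.cfc (f := f k) (a := x)).conjugate p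
  have hnorm := hτ.nonneg_add_norm ((hsa (p * a * p)).sub (hsa a))
  have hcut := hτ.cfc_sub_le_conj hp hpp ha ((hf_cont k).mono hspec)
    fun x hx ↦ (hf_maps k x (hspec hx)).2
  rw [map_sub τ (p * _ * p)] at hnorm
  have hltC := Complex.real_lt_real.2 hlt
  rw [sub_lt_iff_lt_add]
  refine hcut.trans_lt ((sub_nonneg.1 (hnorm.trans_eq ?_)).trans_lt (add_lt_add_right hltC _))
  ring
end

section
/- Let A be a unital C*-algebra, let a ∈ A be a normal element, let λ₀ ∈ ℂ, let ε > 0, and let f : ℂ → [0, 1] be a continuous function whose support is contained in the open ball of radius ε centered at λ₀. Let p ∈ A be a projection belonging to the hereditary subalgebra generated by f(a), i.e. p lies in the norm closure of {f(a) · x · f(a) : x ∈ A}. Then ‖p a − a p‖ < 2ε and ‖p a p − λ₀ p‖ < ε. -/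
section RealSymbol

variable {A : Type*} [CStarAlgebra A] {a : A}

/-- An element annihilating `c` on the right annihilates the closure of `c A c`. -/
lemma mul_eq_zero_of_mem_closure_corner {g c p : A} (hgc : g * c = 0)
    (hp : p ∈ closure {y : A | ∃ x : A, y = c * x * c}) : g * p = 0 := by
  have hclosed : IsClosed {y : A | g * y = 0} :=
    isClosed_eq (continuous_const.mul continuous_id) continuous_const
  refine closure_minimal ?_ hclosed hp
  rintro _ ⟨x, rfl⟩
  simp [← mul_assoc, hgc]

/-- The continuous functional calculus of a nonnegative function is positive. -/
lemma cfc_ofReal_nonneg [PartialOrder A] [StarOrderedRing A] {u : ℂ → ℝ} (hu : Continuous u)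
    (h0 : ∀ z ∈ spectrum ℂ a, 0 ≤ u z) : 0 ≤ cfc (fun z => (u z : ℂ)) a := by
  have hsq : cfc (fun z => (u z : ℂ)) a =
      star (cfc (fun z => ((√(u z) : ℝ) : ℂ)) a) * cfc (fun z => ((√(u z) : ℝ) : ℂ)) a := by
    rw [← cfc_star, ← cfc_mul _ _ a (by fun_prop) (by fun_prop)]
    refine cfc_congr fun z hz => ?_
    simp only [RCLike.star_def, Complex.conj_ofReal]
    rw [← Complex.ofReal_mul, Real.mul_self_sqrt (h0 z hz)]
  rw [hsq]
  exact star_mul_self_nonneg _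

/-- If `u ≤ v` on the spectrum of `a` and `0 ≤ u`, then compressing by a self-adjoint element
preserves the inequality in norm. -/
lemma norm_compression_cfc_le {u v : ℂ → ℝ}
    (hu : Continuous u) (hv : Continuous v) (h0 : ∀ z ∈ spectrum ℂ a, 0 ≤ u z)
    (huv : ∀ z ∈ spectrum ℂ a, u z ≤ v z) {p : A} (hp : IsSelfAdjoint p) :
    ‖p * cfc (fun z => (u z : ℂ)) a * p‖ ≤ ‖p * cfc (fun z => (v z : ℂ)) a * p‖ := by
  let _ := CStarAlgebra.spectralOrder A
  have := CStarAlgebra.spectralOrderedRing A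
  have hle : cfc (fun z => (u z : ℂ)) a ≤ cfc (fun z => (v z : ℂ)) a := by
    rw [← sub_nonneg, ← cfc_sub _ _ a (by fun_prop) (by fun_prop)]
    have := cfc_ofReal_nonneg (a := a) (hv.sub hu) fun z hz => sub_nonneg.2 (huv z hz)
    simpa using this
  exact CStarAlgebra.norm_le_norm_of_nonneg_of_le
    (hp.conjugate_nonneg (cfc_ofReal_nonneg hu h0)) (hp.conjugate_le_conjugate hle)

/-- A real function with values in `[0, r]` on the spectrum gives an element of norm at most `r`. -/
lemma norm_cfc_ofReal_le {u : ℂ → ℝ} {r : ℝ} (hr : 0 ≤ r)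
    (hu : ∀ z ∈ spectrum ℂ a, u z ∈ Set.Icc 0 r) : ‖cfc (fun z => (u z : ℂ)) a‖ ≤ r := by
  refine norm_cfc_le hr fun z hz => ?_
  rw [Complex.norm_real, Real.norm_of_nonneg (hu z hz).1]
  exact (hu z hz).2

lemma IsSelfAdjoint.norm_le_one_of_mul_self_eq {p : A} (hp : IsSelfAdjoint p) (hpp : p * p = p) :
    ‖p‖ ≤ 1 := by
  have h := CStarRing.norm_star_mul_self (x := p)
  rw [hp.star_eq, hpp] at h
  nlinarith [norm_nonneg p]

/-- The continuous cutoff of `f` that vanishes where `f ≤ δ` and equals `1` where `2 * δ ≤ f`. -/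
noncomputable def cutoff (f : ℂ → ℝ) (δ : ℝ) (z : ℂ) : ℝ := max 0 (min 1 (f z / δ - 1))

lemma continuous_cutoff {f : ℂ → ℝ} (hf : Continuous f) (δ : ℝ) : Continuous (cutoff f δ) := by
  unfold cutoff
  fun_prop

lemma cutoff_mem_Icc (f : ℂ → ℝ) (δ : ℝ) (z : ℂ) : cutoff f δ z ∈ Set.Icc 0 1 :=
  ⟨le_max_left _ _, max_le zero_le_one (min_le_left _ _)⟩

lemma cutoff_eq_zero {f : ℂ → ℝ} {δ : ℝ} (hδ : 0 < δ) {z : ℂ} (hz : f z ≤ δ) :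
    cutoff f δ z = 0 := by
  have : f z / δ ≤ 1 := (div_le_one hδ).2 hz
  exact max_eq_left ((min_le_right _ _).trans (by linarith))

lemma one_sub_cutoff_mul_mem_Icc {f : ℂ → ℝ} {δ : ℝ} (hδ : 0 < δ) {z : ℂ} (hz : 0 ≤ f z) :
    (1 - cutoff f δ z) * f z ∈ Set.Icc 0 (2 * δ) := by
  obtain ⟨h0, h1⟩ := cutoff_mem_Icc f δ z
  refine ⟨mul_nonneg (by linarith) hz, ?_⟩
  rcases le_total (f z) (2 * δ) with h | h
  · nlinarith
  · have h2 : 2 ≤ f z / δ := (le_div_iff₀ hδ).2 h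
    have : cutoff f δ z = 1 := by
      rw [cutoff, min_eq_left (by linarith), max_eq_right zero_le_one]
    rw [this]
    linarith

/-- Cutoffs of `f` act almost as a unit on the hereditary subalgebra generated by `f(a)`. -/
lemma exists_norm_cfc_one_sub_cutoff_mul_le {f : ℂ → ℝ}
    (hf : Continuous f) (hf_maps : ∀ z, f z ∈ Set.Icc (0 : ℝ) 1) {p : A}
    (hp : p ∈ closure
      {y : A | ∃ x : A, y = cfc (fun z => (f z : ℂ)) a * x * cfc (fun z => (f z : ℂ)) a}) :
    ∃ δ > 0, ‖cfc (fun z => ((1 - cutoff f δ z : ℝ) : ℂ)) a * p‖ ≤ 1 / 2 := by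
  obtain ⟨_, ⟨x, rfl⟩, hx⟩ := Metric.mem_closure_iff.1 hp (1 / 4) (by norm_num)
  rw [dist_eq_norm] at hx
  set F := cfc (fun z => (f z : ℂ)) a with hF
  have hx0 := norm_nonneg x
  refine ⟨1 / (8 * (‖x‖ + 1)), by positivity, ?_⟩
  set δ := 1 / (8 * (‖x‖ + 1)) with hδ_def
  have hδ : 0 < δ := by positivity
  set G := cfc (fun z => ((1 - cutoff f δ z : ℝ) : ℂ)) a with hG
  have hcut := continuous_cutoff hf δ
  have hGn : ‖G‖ ≤ 1 := norm_cfc_ofReal_le zero_le_one fun z _ => by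
    obtain ⟨h0, h1⟩ := cutoff_mem_Icc f δ z
    exact ⟨by linarith, by linarith⟩
  have hFn : ‖F‖ ≤ 1 := norm_cfc_ofReal_le zero_le_one fun z _ => hf_maps z
  have hGF : ‖G * F‖ ≤ 2 * δ := by
    rw [hG, hF, ← cfc_mul _ _ a (by fun_prop) (by fun_prop)]
    simp only [← Complex.ofReal_mul]
    exact norm_cfc_ofReal_le (by positivity) fun z _ =>
      one_sub_cutoff_mul_mem_Icc hδ (hf_maps z).1
  have hδx : 2 * δ * ‖x‖ ≤ 1 / 4 := by
    rw [hδ_def, ← sub_nonneg]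
    field_simp
    linarith
  calc ‖G * p‖ = ‖G * (p - F * x * F) + G * F * x * F‖ := by congr 1; noncomm_ring
    _ ≤ ‖G‖ * ‖p - F * x * F‖ + ‖G * F‖ * ‖x‖ * ‖F‖ :=
      (norm_add_le _ _).trans (add_le_add (norm_mul_le _ _) (norm_mul₃_le))
    _ ≤ 1 * (1 / 4) + 2 * δ * ‖x‖ * 1 := by gcongr
    _ ≤ 1 / 2 := by linarith

/-- On the compact set `K ∩ {δ ≤ f}` the distance to `lam` stays uniformly below `ε`. -/
lemma exists_normSq_le_of_support_subset_ball {K : Set ℂ} (hK : IsCompact K) {f : ℂ → ℝ}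
    (hf : Continuous f) {lam : ℂ} {ε δ : ℝ} (hε : 0 < ε) (hδ : 0 < δ)
    (hf_supp : Function.support f ⊆ Metric.ball lam ε) :
    ∃ c > 0, c ≤ ε ^ 2 ∧ ∀ z ∈ K, δ ≤ f z → ‖z - lam‖ ^ 2 ≤ ε ^ 2 - c := by
  have hS : IsCompact (K ∩ {z | δ ≤ f z}) :=
    hK.inter_right (isClosed_le continuous_const hf)
  rcases (K ∩ {z | δ ≤ f z}).eq_empty_or_nonempty with h | h
  · refine ⟨ε ^ 2, by positivity, le_rfl, fun z hz hfz => ?_⟩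
    have : z ∈ K ∩ {z | δ ≤ f z} := ⟨hz, hfz⟩
    simp [h] at this
  · obtain ⟨w, hw, hmax⟩ := hS.exists_isMaxOn h
      (f := fun z => ‖z - lam‖ ^ 2) (by fun_prop)
    have hwε : ‖w - lam‖ < ε := by
      rw [← dist_eq_norm]
      exact hf_supp (hδ.trans_le hw.2).ne'
    refine ⟨ε ^ 2 - ‖w - lam‖ ^ 2, ?_, ?_, fun z hz hfz => ?_⟩
    · nlinarith [norm_nonneg (w - lam)]
    · nlinarith [norm_nonneg (w - lam)]
    · have : ‖z - lam‖ ^ 2 ≤ ‖w - lam‖ ^ 2 := hmax ⟨hz, hfz⟩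
      linarith

/-- A projection in the hereditary subalgebra generated by `f(a)`, with `f` supported in the ball
of radius `ε` about `lam`, satisfies `‖(a - lam) p‖ < ε`. -/
lemma norm_sub_algebraMap_mul_lt (ha : IsStarNormal a) {lam : ℂ} {ε : ℝ} (hε : 0 < ε)
    {f : ℂ → ℝ} (hf : Continuous f) (hf_maps : ∀ z, f z ∈ Set.Icc (0 : ℝ) 1)
    (hf_supp : Function.support f ⊆ Metric.ball lam ε)
    {p : A} (hp_sa : IsSelfAdjoint p) (hp_idem : p * p = p)
    (hp : p ∈ closure
      {y : A | ∃ x : A, y = cfc (fun z => (f z : ℂ)) a * x * cfc (fun z => (f z : ℂ)) a}) :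
    ‖(a - algebraMap ℂ A lam) * p‖ < ε := by
  obtain ⟨δ, hδ, hG⟩ := exists_norm_cfc_one_sub_cutoff_mul_le hf hf_maps hp
  obtain ⟨c, hc, hcε, hcS⟩ := exists_normSq_le_of_support_subset_ball
    (spectrum.isCompact (𝕜 := ℂ) a) hf hε hδ hf_supp
  have hcut := continuous_cutoff hf δ
  set b := a - algebraMap ℂ A lam with hb
  set G := cfc (fun z => ((1 - cutoff f δ z : ℝ) : ℂ)) a with hG_def
  have hb_cfc : b = cfc (fun z => z - lam) a := by
    rw [cfc_sub _ _ a, cfc_id' ℂ a, cfc_const lam a]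
  have hbb : star b * b = cfc (fun z => ((‖z - lam‖ ^ 2 : ℝ) : ℂ)) a := by
    rw [hb_cfc, ← cfc_star, ← cfc_mul _ _ a (by fun_prop) (by fun_prop)]
    refine cfc_congr fun z _ => ?_
    simp only [RCLike.star_def]
    rw [Complex.conj_mul']
    push_cast
    rfl
  have hmin : star b * b * p = cfc (fun z => ((min (‖z - lam‖ ^ 2) (ε ^ 2) : ℝ) : ℂ)) a * p := by
    rw [← sub_eq_zero, ← sub_mul, hbb, ← cfc_sub _ _ a (by fun_prop) (by fun_prop)]
    refine mul_eq_zero_of_mem_closure_corner ?_ hp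
    rw [← cfc_mul _ _ a (by fun_prop) (by fun_prop), ← cfc_zero ℂ a]
    refine cfc_congr fun z _ => ?_
    by_cases hz : f z = 0
    · simp [hz]
    · have hzε : ‖z - lam‖ < ε := by
        rw [← dist_eq_norm]
        exact hf_supp hz
      have hle : ‖z - lam‖ ^ 2 ≤ ε ^ 2 := by gcongr
      simp [min_eq_left hle]
  have hcfc : cfc (fun z => ((ε ^ 2 - c * cutoff f δ z : ℝ) : ℂ)) a
      = ((ε ^ 2 - c : ℝ) : ℂ) • (1 : A) + (c : ℂ) • G := by
    rw [hG_def, ← cfc_const_mul _ _ a (by fun_prop), ← Algebra.algebraMap_eq_smul_one,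
      ← cfc_const_add _ _ a (by fun_prop)]
    refine cfc_congr fun z _ => ?_
    push_cast
    ring
  have hp1 := hp_sa.norm_le_one_of_mul_self_eq hp_idem
  have hsq : ‖b * p‖ * ‖b * p‖ < ε ^ 2 := by
    calc ‖b * p‖ * ‖b * p‖ = ‖p * (star b * b * p)‖ := by
          rw [← CStarRing.norm_star_mul_self, star_mul, hp_sa.star_eq]
          simp only [mul_assoc]
      _ = ‖p * cfc (fun z => ((min (‖z - lam‖ ^ 2) (ε ^ 2) : ℝ) : ℂ)) a * p‖ := by
          rw [hmin, mul_assoc]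
      _ ≤ ‖p * cfc (fun z => ((ε ^ 2 - c * cutoff f δ z : ℝ) : ℂ)) a * p‖ := by
          refine norm_compression_cfc_le (by fun_prop) (by fun_prop)
            (fun z _ => by positivity) (fun z hz => ?_) hp_sa
          rcases le_total (f z) δ with h | h
          · rw [cutoff_eq_zero hδ h]
            simp
          · have := (cutoff_mem_Icc f δ z).2
            refine (min_le_left _ _).trans ((hcS z hz h).trans ?_)
            nlinarith
      _ = ‖((ε ^ 2 - c : ℝ) : ℂ) • p + (c : ℂ) • (p * (G * p))‖ := by
          rw [hcfc]
          simp [mul_add, add_mul, hp_idem, mul_assoc]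
      _ ≤ (ε ^ 2 - c) * ‖p‖ + c * (‖p‖ * ‖G * p‖) := by
          refine (norm_add_le _ _).trans ?_
          rw [norm_smul, norm_smul, Complex.norm_real, Complex.norm_real,
            Real.norm_of_nonneg (by linarith), Real.norm_of_nonneg hc.le]
          gcongr
          exact norm_mul_le _ _
      _ ≤ (ε ^ 2 - c) * 1 + c * (1 * (1 / 2)) := by
          have : 0 ≤ ε ^ 2 - c := by linarith
          gcongr
      _ < ε ^ 2 := by linarith
  nlinarith [norm_nonneg (b * p)]

end RealSymbol


/-- Let `A` be a unital C*-algebra, `a ∈ A` normal, `λ₀ ∈ ℂ`, `ε > 0`, and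
`f : ℂ → [0,1]` continuous with support contained in the open ball of radius `ε` about
`λ₀`.  If `p` is a projection in the hereditary subalgebra generated by `f(a)` (the norm
closure of `{f(a) x f(a) : x ∈ A}`), then `‖pa - ap‖ < 2ε` and `‖pap - λ₀p‖ < ε`. -/
theorem stmt_8 {A : Type*} [CStarAlgebra A] (a : A) (ha : IsStarNormal a)
    (lam : ℂ) (ε : ℝ) (hε : 0 < ε)
    (f : ℂ → ℝ) (hf_cont : Continuous f) (hf_maps : ∀ z, f z ∈ Set.Icc (0 : ℝ) 1)
    (hf_supp : Function.support f ⊆ Metric.ball lam ε)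
    (p : A) (hp_sa : IsSelfAdjoint p) (hp_idem : p * p = p)
    (hp_mem : p ∈ closure
      {y : A | ∃ x : A, y = cfc (fun z => (f z : ℂ)) a * x * cfc (fun z => (f z : ℂ)) a}) :
    ‖p * a - a * p‖ < 2 * ε ∧ ‖p * a * p - lam • p‖ < ε := by
  set b := a - algebraMap ℂ A lam with hb
  have hbp : ‖b * p‖ < ε :=
    norm_sub_algebraMap_mul_lt ha hε hf_cont hf_maps hf_supp hp_sa hp_idem hp_mem
  have hb_normal : b * star b = star b * b := by
    have hb_cfc : b = cfc (fun z => z - lam) a := by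
      rw [cfc_sub _ _ a, cfc_id' ℂ a, cfc_const lam a]
    have hn : IsStarNormal b := hb_cfc ▸ cfc_predicate _ a
    exact hn.star_comm_self.eq.symm
  have hpb : ‖p * b‖ = ‖b * p‖ := by
    have h : ‖p * b‖ * ‖p * b‖ = ‖b * p‖ * ‖b * p‖ := by
      rw [← CStarRing.norm_self_mul_star, ← CStarRing.norm_star_mul_self, star_mul, star_mul,
        hp_sa.star_eq, mul_assoc, ← mul_assoc b, hb_normal]
      simp only [mul_assoc]
    exact (mul_self_inj (norm_nonneg _) (norm_nonneg _)).1 h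
  constructor
  · have : p * a - a * p = p * b - b * p := by
      rw [hb, mul_sub, sub_mul, Algebra.commutes lam p]
      abel
    rw [this]
    linarith [norm_sub_le (p * b) (b * p)]
  · have : p * a * p - lam • p = p * (b * p) := by
      rw [hb, sub_mul, mul_sub, mul_assoc, ← Algebra.smul_def, mul_smul_comm, hp_idem]
    rw [this]
    have hp1 := hp_sa.norm_le_one_of_mul_self_eq hp_idem
    calc ‖p * (b * p)‖ ≤ ‖p‖ * ‖b * p‖ := norm_mul_le _ _
      _ ≤ 1 * ‖b * p‖ := by gcongr
      _ < ε := by rwa [one_mul]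
end

section
/- Let A be a unital AF algebra such that for every normalized trace τ on A and every nonzero projection p ∈ A, the value τ(p) is a strictly positive real number. Then A is simple: every closed two-sided ideal of A equals {0} or A. -/
open scoped ComplexOrder

/-- The trace of a representation on a nonzero finite-dimensional space, divided by the
dimension, is a contractive positive tracial functional. -/
lemma exists_trace_of_representation {C V : Type*} [CStarAlgebra C] [AddCommGroup V] [Module ℂ V]
    [FiniteDimensional ℂ V] [Nontrivial V] (ρ : C →ₐ[ℂ] Module.End ℂ V) :
    ∃ τ : C →ₗ[ℂ] ℂ, IsNormalizedTrace τ ∧ (∀ a, ‖τ a‖ ≤ ‖a‖) ∧ ∀ a, ρ a = 0 → τ a = 0 := by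
  have : Nontrivial C := by
    refine ⟨⟨0, 1, fun h => ?_⟩⟩
    have h' : (0 : Module.End ℂ V) = 1 := by simpa using congrArg ρ h
    exact zero_ne_one h'
  have hd : (Module.finrank ℂ V : ℂ) ≠ 0 := by
    exact_mod_cast (Module.finrank_pos (R := ℂ) (M := V)).ne'
  have hdpos : (0 : ℝ) < Module.finrank ℂ V := by
    exact_mod_cast (Module.finrank_pos (R := ℂ) (M := V))
  have hsum (a : C) : LinearMap.trace ℂ V (ρ a) = (ρ a).charpoly.roots.sum :=
    Module.End.trace_eq_sum_roots_charpoly_of_splits (IsAlgClosed.splits _)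
  have hspec (a : C) (z : ℂ) (hz : z ∈ (ρ a).charpoly.roots) : z ∈ spectrum ℂ a :=
    AlgHom.spectrum_apply_subset ρ a
      ((Module.End.mem_spectrum_iff_isRoot_charpoly _ _).2 (Polynomial.isRoot_of_mem_roots hz))
  refine ⟨(Module.finrank ℂ V : ℂ)⁻¹ • (LinearMap.trace ℂ V ∘ₗ ρ.toLinearMap),
    ⟨?_, fun a => ?_, fun a b => ?_⟩, fun a => ?_, fun a ha => ?_⟩
  · simp [hd]
  · have h0 : 0 ≤ LinearMap.trace ℂ V (ρ (star a * a)) := by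
      rw [hsum]
      refine Multiset.sum_nonneg fun z hz => ?_
      have hz' := hspec _ z hz
      have hre := (IsSelfAdjoint.star_mul_self a).mem_spectrum_eq_re hz'
      rw [hre] at hz' ⊢
      have := spectrum_star_mul_self_nonneg z.re
        ((spectrum.algebraMap_mem_iff ℂ (R := ℝ)).1 hz')
      exact_mod_cast this
    have h1 : (0 : ℂ) ≤ (Module.finrank ℂ V : ℂ)⁻¹ := inv_nonneg.2 (Nat.cast_nonneg _)
    simpa using mul_nonneg h1 h0
  · simp [LinearMap.trace_mul_comm]
  · have h0 : ‖LinearMap.trace ℂ V (ρ a)‖ ≤ Module.finrank ℂ V * ‖a‖ := by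
      rw [hsum]
      have hcard : (Module.finrank ℂ V) = (ρ a).charpoly.roots.card := by
        rw [← (IsAlgClosed.splits (ρ a).charpoly).natDegree_eq_card_roots,
          LinearMap.charpoly_natDegree]
      refine (norm_multiset_sum_le _).trans ?_
      have := Multiset.sum_le_card_nsmul ((ρ a).charpoly.roots.map fun z => ‖z‖) ‖a‖ ?_
      · simpa [hcard] using this
      · intro x hx
        obtain ⟨z, hz, rfl⟩ := Multiset.mem_map.1 hx
        exact spectrum.norm_le_norm_of_mem (hspec a z hz)
    simp only [LinearMap.smul_apply, LinearMap.comp_apply, AlgHom.toLinearMap_apply, norm_smul,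
      norm_inv, Complex.norm_natCast]
    rwa [inv_mul_le_iff₀ hdpos]
  · simp [ha]

/-- A finite-dimensional C*-algebra mapping to a nontrivial algebra carries a contractive
normalized trace vanishing on the kernel. -/
lemma exists_trace_of_algHom {C Q : Type*} [CStarAlgebra C] [FiniteDimensional ℂ C] [Ring Q]
    [Algebra ℂ Q] [Nontrivial Q] (φ : C →ₐ[ℂ] Q) :
    ∃ τ : C →ₗ[ℂ] ℂ, IsNormalizedTrace τ ∧ (∀ a, ‖τ a‖ ≤ ‖a‖) ∧ ∀ a, φ a = 0 → τ a = 0 := by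
  have : FiniteDimensional ℂ φ.range :=
    Module.Finite.of_surjective φ.rangeRestrict.toLinearMap φ.rangeRestrict_surjective
  obtain ⟨τ, h1, h2, h3⟩ :=
    exists_trace_of_representation ((Algebra.lmul ℂ φ.range).comp φ.rangeRestrict)
  refine ⟨τ, h1, h2, fun a ha => h3 a ?_⟩
  have : φ.rangeRestrict a = 0 := Subtype.ext ha
  simp [this]

/-- An element of a finite-dimensional real algebra has finite spectrum. -/
lemma finite_real_spectrum_of_finiteDimensional {C : Type*} [Ring C] [Algebra ℝ C]
    [FiniteDimensional ℝ C] (b : C) : (spectrum ℝ b).Finite := by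
  nontriviality C
  refine ((minpoly ℝ b).roots.toFinset.finite_toSet).subset fun z hz => ?_
  have h := spectrum.subset_polynomial_aeval b (minpoly ℝ b) ⟨z, hz, rfl⟩
  rw [minpoly.aeval, spectrum.zero_eq] at h
  simpa [minpoly.ne_zero (Algebra.IsIntegral.isIntegral b)] using h

/-- In a finite-dimensional C*-algebra, the top spectral projection of `star c * c`. -/
lemma exists_top_spectral_projection {C : Type*} [CStarAlgebra C] [FiniteDimensional ℂ C]
    [Nontrivial C] (c : C) :
    ∃ q : C, IsSelfAdjoint q ∧ q * q = q ∧ q ≠ 0 ∧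
      (star c * c) * q = (‖star c * c‖ : ℂ) • q := by
  let _ := CStarAlgebra.spectralOrder C
  have := CStarAlgebra.spectralOrderedRing C
  set b := star c * c with hb
  have hb0 : 0 ≤ b := star_mul_self_nonneg c
  have hsa : IsSelfAdjoint b := IsSelfAdjoint.star_mul_self c
  have : FiniteDimensional ℝ C := FiniteDimensional.complexToReal C
  have hc (f : ℝ → ℝ) : ContinuousOn f (spectrum ℝ b) :=
    (finite_real_spectrum_of_finiteDimensional b).continuousOn f
  have hr : ‖b‖ ∈ spectrum ℝ b := CStarAlgebra.norm_mem_spectrum_of_nonneg hb0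
  let f : ℝ → ℝ := fun x => if x = ‖b‖ then 1 else 0
  refine ⟨cfc f b, cfc_predicate f b, ?_, fun h => ?_, ?_⟩
  · rw [← cfc_mul f f b (hc _) (hc _)]
    congr 1
    ext x
    simp [f]
  · have h1 : f ‖b‖ ∈ spectrum ℝ (cfc f b) := by
      rw [cfc_map_spectrum f b hsa (hc _)]
      exact ⟨_, hr, rfl⟩
    simp [h, f] at h1
  · have h1 : b * cfc f b = cfc (fun x => x * f x) b := by
      rw [cfc_mul (fun x => x) f b (hc _) (hc _), cfc_id' ℝ b]
    have h2 : cfc (fun x => x * f x) b = ‖b‖ • cfc f b := by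
      rw [← cfc_smul ‖b‖ f b (hc _)]
      congr 1
      ext x
      by_cases hx : x = ‖b‖ <;> simp [f, hx]
    rw [h1, h2, Complex.coe_smul]

/-- An idempotent at distance less than one from an element of a closed ideal belongs to it. -/
lemma mem_of_norm_sub_lt_one {A : Type*} [NormedRing A] (I : TwoSidedIdeal A)
    (hI : IsClosed (I : Set A)) {q y : A} (hq : q * q = q) (hy : y ∈ I) (hqy : ‖q - y‖ < 1) :
    q ∈ I := by
  have hlim : Filter.Tendsto (fun n : ℕ => q - (q - y) ^ (n + 1)) Filter.atTop (nhds q) := by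
    have := (tendsto_pow_atTop_nhds_zero_of_norm_lt_one hqy).comp (Filter.tendsto_add_atTop_nat 1)
    simpa using tendsto_const_nhds.sub this
  refine hI.mem_of_tendsto hlim (Filter.Eventually.of_forall fun n => ?_)
  induction n with
  | zero => simpa using hy
  | succ n ih =>
    have h : q - (q - y) ^ (n + 1 + 1) = (q - (q - y) ^ (n + 1)) * q + (q - y) ^ (n + 1) * y := by
      rw [pow_succ (q - y) (n + 1), sub_mul, hq]
      noncomm_ring
    change q - (q - y) ^ (n + 1 + 1) ∈ I
    rw [h]
    exact I.add_mem (I.mul_mem_right _ _ ih) (I.mul_mem_left _ _ hy)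

/-- A nonzero closed ideal contains a nonzero projection from any dense union of
finite-dimensional *-subalgebras. -/
lemma exists_projection_mem {A : Type*} [CStarAlgebra A] (B : ℕ → StarSubalgebra ℂ A)
    (hfin : ∀ k, FiniteDimensional ℂ (B k)) (hdense : Dense (⋃ k, (B k : Set A)))
    (I : TwoSidedIdeal A) (hI : IsClosed (I : Set A)) {a : A} (haI : a ∈ I) (ha : a ≠ 0) :
    ∃ k, ∃ q ∈ B k, q ∈ I ∧ IsSelfAdjoint q ∧ q * q = q ∧ q ≠ 0 := by
  have : Nontrivial A := ⟨a, 0, ha⟩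
  have hopen : IsOpen {c : A | ‖star c * c - star a * a‖ < ‖star c * c‖} :=
    isOpen_lt (by fun_prop) (by fun_prop)
  obtain ⟨c, hc, hcB⟩ := hdense.inter_open_nonempty _ hopen
    ⟨a, by simpa [CStarRing.norm_star_mul_self] using ha⟩
  obtain ⟨k, hck⟩ := Set.mem_iUnion.1 hcB
  have hfk := hfin k
  have : IsClosed (B k : Set A) := Submodule.closed_of_finiteDimensional
    (Subalgebra.toSubmodule (B k).toSubalgebra)
  have : Nontrivial (B k) := ⟨0, 1, fun h => zero_ne_one (congrArg Subtype.val h)⟩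
  obtain ⟨q, hsa, hqq, hq0, hbq⟩ := exists_top_spectral_projection (⟨c, hck⟩ : B k)
  have hsa' : IsSelfAdjoint (q : A) := congrArg Subtype.val hsa
  have hqq' : (q : A) * q = q := congrArg Subtype.val hqq
  have hq0' : (q : A) ≠ 0 := fun h => hq0 (Subtype.ext h)
  have hbq' : star c * c * q = (‖star c * c‖ : ℂ) • (q : A) := congrArg Subtype.val hbq
  refine ⟨k, q, q.2, ?_, hsa', hqq', hq0'⟩
  set r := ‖star c * c‖ with hr
  have hr0 : 0 < r := (norm_nonneg _).trans_lt hc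
  have hrc : (r : ℂ) ≠ 0 := by exact_mod_cast hr0.ne'
  have hqn : ‖(q : A)‖ ≤ 1 := by
    have h := CStarRing.norm_star_mul_self (x := (q : A))
    rw [hsa'.star_eq, hqq'] at h
    have : 0 < ‖(q : A)‖ := norm_pos_iff.2 hq0'
    nlinarith
  have haI' : star a * a ∈ I := I.mul_mem_left _ _ haI
  refine mem_of_norm_sub_lt_one I hI (y := ((r : ℂ)⁻¹ • (1 : A)) * (star a * a) * q) hqq'
    (I.mul_mem_right _ _ (I.mul_mem_left _ _ haI')) ?_
  have h : (q : A) - ((r : ℂ)⁻¹ • (1 : A)) * (star a * a) * q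
      = (r : ℂ)⁻¹ • ((star c * c - star a * a) * q) := by
    rw [sub_mul, hbq', smul_sub, smul_smul, inv_mul_cancel₀ hrc, one_smul]
    simp [mul_assoc]
  rw [h, norm_smul, norm_inv, Complex.norm_real, norm_norm, inv_mul_lt_iff₀ hr0, mul_one]
  calc ‖(star c * c - star a * a) * q‖ ≤ ‖star c * c - star a * a‖ * ‖(q : A)‖ := norm_mul_le _ _
    _ ≤ ‖star c * c - star a * a‖ := mul_le_of_le_one_right (norm_nonneg _) hqn
    _ < r := hc

/-- If an AF algebra maps to a nontrivial algebra, it has a normalized trace vanishing on the part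
of the kernel lying in the dense union of finite-dimensional *-subalgebras. -/
lemma exists_normalizedTrace_vanishing {A Q : Type*} [CStarAlgebra A] [Ring Q] [Algebra ℂ Q]
    [Nontrivial Q] (B : ℕ → StarSubalgebra ℂ A) (hmono : Monotone B)
    (hfin : ∀ k, FiniteDimensional ℂ (B k)) (hdense : Dense (⋃ k, (B k : Set A)))
    (π : A →ₐ[ℂ] Q) :
    ∃ τ : A →ₗ[ℂ] ℂ, IsNormalizedTrace τ ∧ ∀ k, ∀ a ∈ B k, π a = 0 → τ a = 0 := by
  have hext (k : ℕ) : ∃ g : StrongDual ℂ A, ‖g‖ ≤ 1 ∧ g 1 = 1 ∧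
      (∀ a ∈ B k, 0 ≤ g (star a * a)) ∧ (∀ a ∈ B k, ∀ b ∈ B k, g (a * b) = g (b * a)) ∧
      ∀ a ∈ B k, π a = 0 → g a = 0 := by
    have hfk := hfin k
    have : IsClosed (B k : Set A) := Submodule.closed_of_finiteDimensional
      (Subalgebra.toSubmodule (B k).toSubalgebra)
    obtain ⟨τ, ⟨h1, hpos, hcomm⟩, hnorm, hker⟩ :=
      exists_trace_of_algHom (π.comp (B k).subtype.toAlgHom)
    let f : StrongDual ℂ (Subalgebra.toSubmodule (B k).toSubalgebra) :=
      LinearMap.mkContinuous (τ : (B k) →ₗ[ℂ] ℂ) 1 (fun a => (hnorm a).trans_eq (one_mul _).symm)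
    obtain ⟨g, hg, hgn⟩ := exists_extension_norm_eq _ f
    have hgτ (a : B k) : g a = τ a := hg a
    refine ⟨g, hgn.le.trans (LinearMap.mkContinuous_norm_le _ zero_le_one _), ?_, ?_, ?_, ?_⟩
    · exact (hgτ 1).trans h1
    · intro a ha
      exact (hpos ⟨a, ha⟩).trans_eq (hgτ (star ⟨a, ha⟩ * ⟨a, ha⟩)).symm
    · intro a ha b hb
      exact (hgτ (⟨a, ha⟩ * ⟨b, hb⟩)).trans
        ((hcomm ⟨a, ha⟩ ⟨b, hb⟩).trans (hgτ (⟨b, hb⟩ * ⟨a, ha⟩)).symm)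
    · intro a ha h
      exact (hgτ ⟨a, ha⟩).trans (hker ⟨a, ha⟩ h)
  choose g hgn hg1 hgpos hgcomm hgker using hext
  let U : Ultrafilter ℕ := Filter.hyperfilter ℕ
  have hU : (U : Filter ℕ) ≤ Filter.atTop := Nat.hyperfilter_le_atTop
  obtain ⟨t, -, ht⟩ := (WeakDual.isCompact_closedBall (𝕜 := ℂ) (E := A) 0 1).ultrafilter_le_nhds
    (U.map fun k => StrongDual.toWeakDual (g k)) (by
      refine Filter.le_principal_iff.2 (Filter.mem_map.2 (Filter.univ_mem' fun k => ?_))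
      simpa using hgn k)
  have hlim (a : A) : Filter.Tendsto (fun k => g k a) U (nhds (t a)) :=
    ((WeakDual.eval_continuous a).tendsto t).comp (f := fun k => StrongDual.toWeakDual (g k)) ht
  have hev {k : ℕ} {P : ℕ → Prop} (h : ∀ j, k ≤ j → P j) : ∀ᶠ j in (U : Filter ℕ), P j :=
    hU (Filter.eventually_atTop.2 ⟨k, h⟩)
  have htc : Continuous t := t.continuous
  refine ⟨(WeakDual.toStrongDual t).toLinearMap, ⟨?_, ?_, ?_⟩, ?_⟩
  · exact tendsto_nhds_unique (hlim 1) (by simpa only [hg1] using tendsto_const_nhds)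
  · intro a
    refine hdense.induction (P := fun a => 0 ≤ t (star a * a)) ?_
      (isClosed_le continuous_const (by fun_prop)) a
    intro b hb
    obtain ⟨k, hk⟩ := Set.mem_iUnion.1 hb
    exact ge_of_tendsto (hlim _) (hev fun j hj => hgpos j b (hmono hj hk))
  · intro a b
    change t (a * b) = t (b * a)
    refine hdense.induction (P := fun a => t (a * b) = t (b * a)) ?_
      (isClosed_eq (by fun_prop) (by fun_prop)) a
    intro a ha
    refine hdense.induction (P := fun b => t (a * b) = t (b * a)) ?_
      (isClosed_eq (by fun_prop) (by fun_prop)) b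
    intro b hb
    obtain ⟨k, hk⟩ := Set.mem_iUnion.1 ha
    obtain ⟨l, hl⟩ := Set.mem_iUnion.1 hb
    refine tendsto_nhds_unique_of_eventuallyEq (hlim _) (hlim _) (hev (k := max k l) fun j hj => ?_)
    exact hgcomm j a (hmono ((le_max_left _ _).trans hj) hk) b
      (hmono ((le_max_right _ _).trans hj) hl)
  · intro k a ha h
    exact tendsto_nhds_unique_of_eventuallyEq (hlim a) tendsto_const_nhds
      (hev fun j hj => hgker j a (hmono hj ha) h)

/-- Let `A` be a unital AF algebra such that `τ(p) > 0` (a strictly positive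
real number) for every normalized trace `τ` and every nonzero projection `p ∈ A`.  Then
`A` is simple: every closed two-sided ideal is `{0}` or `A`. -/
theorem stmt_10 {A : Type*} [CStarAlgebra A] (hA : IsAFAlgebra A)
    (htr : ∀ τ : A →ₗ[ℂ] ℂ, IsNormalizedTrace τ →
      ∀ p : A, IsSelfAdjoint p → p * p = p → p ≠ 0 → 0 < τ p) :
    ∀ I : TwoSidedIdeal A, IsClosed (I : Set A) → I = ⊥ ∨ I = ⊤ := by
  intro I hI
  obtain ⟨B, hmono, hfin, hdense⟩ := hA
  by_contra! hne
  obtain ⟨hbot, htop⟩ := hne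
  obtain ⟨a, haI, ha⟩ : ∃ a ∈ I, a ≠ 0 := by
    by_contra! h
    exact hbot (le_bot_iff.1 fun x hx => (TwoSidedIdeal.mem_bot A).2 (h x hx))
  obtain ⟨k, q, hqB, hqI, hsa, hqq, hq0⟩ := exists_projection_mem B hfin hdense I hI haI ha
  have : Nontrivial I.ringCon.Quotient := by
    refine ⟨1, 0, fun h => htop (I.one_mem_iff.1 ?_)⟩
    exact (I.ringCon.eq).1 h
  obtain ⟨τ, hτ, hker⟩ :=
    exists_normalizedTrace_vanishing B hmono hfin hdense (I.ringCon.mkₐ (α := ℂ))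
  have hz : τ q = 0 := hker k q hqB ((I.ringCon.eq).2 hqI)
  exact (htr τ hτ q hsa hqq hq0).ne' hz
end

section
/- Let A be a unital C*-algebra with the property that for every selfadjoint a ∈ A and every ε > 0 there exists a selfadjoint b ∈ A with finite spectrum such that ‖a − b‖ < ε. Then there exists a subset S of the selfadjoint part A_sa of A which is a countable intersection of subsets that are open and dense in A_sa (in the norm topology), i.e. a dense Gδ-set in A_sa, such that every element of S has totally disconnected spectrum. -/
/-- If the spectrum of `b` is finite, then `r` can be removed from the spectrum of `b` by
arbitrarily small real translations. -/
theorem exists_pos_lt_notMem_spectrum_add_algebraMap {A : Type*} [Ring A] [Algebra ℂ A]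
    {b : A} (hb : (spectrum ℂ b).Finite) (r : ℂ) {ε : ℝ} (hε : 0 < ε) :
    ∃ t : ℝ, 0 < t ∧ t < ε ∧ r ∉ spectrum ℂ (b + algebraMap ℂ A t) := by
  have hfin : {t : ℝ | r - t ∈ spectrum ℂ b}.Finite :=
    hb.preimage fun s _ t _ h => by simpa using h
  obtain ⟨t, ht, hmem⟩ := ((Set.Ioo_infinite hε).sdiff hfin).nonempty
  refine ⟨t, ht.1, ht.2, fun h => hmem ?_⟩
  rw [add_comm, ← spectrum.singleton_add_eq, Set.singleton_add] at h
  obtain ⟨s, hs, rfl⟩ := h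
  simpa using hs

/-- The elements with `r` outside their spectrum form an open set. -/
theorem isOpen_setOf_notMem_spectrum {A : Type*} [NormedRing A] [NormedAlgebra ℂ A]
    [CompleteSpace A] (r : ℂ) : IsOpen {a : A | r ∉ spectrum ℂ a} := by
  simp only [spectrum.notMem_iff]
  exact Units.isOpen.preimage (by fun_prop : Continuous fun a : A => algebraMap ℂ A r - a)

/-- A set of real complex numbers without rational points is totally disconnected. -/
theorem isTotallyDisconnected_of_im_eq_zero_of_ratCast_notMem {s : Set ℂ}
    (him : ∀ z ∈ s, z.im = 0) (hrat : ∀ q : ℚ, (q : ℂ) ∉ s) : IsTotallyDisconnected s := by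
  have hinj : Set.InjOn Complex.re s := fun z hz w hw h =>
    Complex.ext h ((him z hz).trans (him w hw).symm)
  suffices hre : IsTotallyDisconnected (Complex.re '' s) from
    fun t hts ht x hx y hy => hinj (hts hx) (hts hy) <|
      hre _ (Set.image_mono hts) (ht.image _ Complex.continuous_re.continuousOn)
        (Set.mem_image_of_mem _ hx) (Set.mem_image_of_mem _ hy)
  rw [isTotallyDisconnected_iff_lt]
  intro x _ y _ hxy
  obtain ⟨q, hxq, hqy⟩ := exists_rat_btwn hxy
  refine ⟨q, ?_, hxq, hqy⟩
  rintro ⟨z, hz, hzq⟩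
  exact hrat q (by rwa [show (q : ℂ) = z from Complex.ext (by simp [hzq]) (by simp [him z hz])])

/-- In a C⋆-algebra in which the selfadjoint elements of finite spectrum are dense among the
selfadjoint elements, so are those which have a given number outside their spectrum. -/
theorem dense_setOf_notMem_spectrum {A : Type*} [CStarAlgebra A]
    (hA : ∀ a : A, IsSelfAdjoint a → ∀ ε > 0,
      ∃ b : A, IsSelfAdjoint b ∧ (spectrum ℂ b).Finite ∧ ‖a - b‖ < ε) (r : ℂ) :
    Dense {a : {a : A // IsSelfAdjoint a} | r ∉ spectrum ℂ (a : A)} := by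
  rw [Metric.dense_iff]
  rintro ⟨a, ha⟩ ε hε
  cases subsingleton_or_nontrivial A
  · exact ⟨⟨a, ha⟩, Metric.mem_ball_self hε, by simp [spectrum.of_subsingleton]⟩
  obtain ⟨b, hb, hfin, hab⟩ := hA a ha (ε / 2) (half_pos hε)
  obtain ⟨t, ht0, htε, hr⟩ :=
    exists_pos_lt_notMem_spectrum_add_algebraMap hfin r (half_pos hε)
  have ht : IsSelfAdjoint (algebraMap ℂ A t) :=
    (show IsSelfAdjoint (t : ℂ) from Complex.conj_ofReal t).algebraMap A
  refine ⟨⟨b + algebraMap ℂ A t, hb.add ht⟩, ?_, hr⟩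
  rw [Metric.mem_ball, Subtype.dist_eq, dist_comm, dist_eq_norm]
  calc ‖a - (b + algebraMap ℂ A t)‖ = ‖(a - b) - algebraMap ℂ A t‖ := by rw [sub_add_eq_sub_sub]
    _ ≤ ‖a - b‖ + ‖algebraMap ℂ A t‖ := norm_sub_le _ _
    _ < ε / 2 + ε / 2 := by
        gcongr
        rwa [norm_algebraMap', Complex.norm_real, Real.norm_of_nonneg ht0.le]
    _ = ε := add_halves ε

/-- Let `A` be a unital C*-algebra in which every selfadjoint element can be
approximated in norm by selfadjoint elements with finite spectrum (real rank zero).  Then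
there is a subset `S` of the selfadjoint part `A_sa` which is a countable intersection of
open dense subsets of `A_sa` (a dense Gδ-set), all of whose elements have totally
disconnected spectrum. -/
theorem stmt_11 {A : Type*} [CStarAlgebra A]
    (hA : ∀ a : A, IsSelfAdjoint a → ∀ ε > 0,
      ∃ b : A, IsSelfAdjoint b ∧ (spectrum ℂ b).Finite ∧ ‖a - b‖ < ε) :
    ∃ g : ℕ → Set {a : A // IsSelfAdjoint a},
      (∀ k, IsOpen (g k)) ∧ (∀ k, Dense (g k)) ∧ Dense (⋂ k, g k) ∧
      ∀ a ∈ ⋂ k, g k, IsTotallyDisconnected (spectrum ℂ (a : A)) := by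
  obtain ⟨q, hq⟩ := exists_surjective_nat ℚ
  have hclosed : IsClosed {a : A | IsSelfAdjoint a} := isClosed_eq continuous_star continuous_id
  have : CompleteSpace {a : A // IsSelfAdjoint a} := hclosed.completeSpace_coe
  have hopen (k : ℕ) : IsOpen {a : {a : A // IsSelfAdjoint a} | (q k : ℂ) ∉ spectrum ℂ (a : A)} :=
    (isOpen_setOf_notMem_spectrum (q k : ℂ)).preimage continuous_subtype_val
  have hdense (k : ℕ) := dense_setOf_notMem_spectrum hA (q k : ℂ)
  refine ⟨_, hopen, hdense, dense_iInter_of_isOpen_nat hopen hdense, fun a ha => ?_⟩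
  refine isTotallyDisconnected_of_im_eq_zero_of_ratCast_notMem
    (fun z hz => a.2.im_eq_zero_of_mem_spectrum hz) fun p => ?_
  obtain ⟨k, rfl⟩ := hq p
  exact Set.mem_iInter.mp ha k
end

section
/- Let A be a unital C*-algebra with the property that for every selfadjoint a ∈ A and every ε > 0 there exists a selfadjoint b ∈ A with finite spectrum such that ‖a − b‖ < ε, and let F ⊆ ℝ be a finite set. Then the set S_F = {a ∈ A : a is selfadjoint and spectrum(a) ∩ F = ∅} is dense in the selfadjoint part A_sa of A with the norm topology. -/
/-- If two sets of scalars are finite, one of them real, then arbitrarily small positive real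
translations make the first disjoint from the second. -/
theorem exists_pos_lt_forall_add_ne {S : Set ℂ} (hS : S.Finite) {F : Set ℝ} (hF : F.Finite)
    {ε : ℝ} (hε : 0 < ε) :
    ∃ t : ℝ, 0 < t ∧ t < ε ∧ ∀ s ∈ S, ∀ f ∈ F, s + (t : ℂ) ≠ (f : ℂ) := by
  obtain ⟨t, ⟨ht0, htε⟩, ht⟩ :=
    (Set.Ioo_infinite hε).exists_notMem_finite (hF.image2 (fun f s ↦ f - s.re) hS)
  refine ⟨t, ht0, htε, fun s hs f hf h ↦ ht ⟨f, hf, s, hs, ?_⟩⟩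
  have hre := congrArg Complex.re h
  simp only [Complex.add_re, Complex.ofReal_re] at hre
  linarith

/-- Let `A` be a unital C*-algebra in which every selfadjoint element can be
approximated in norm by selfadjoint elements with finite spectrum (real rank zero), and let
`F ⊆ ℝ` be finite.  Then `S_F = {a ∈ A_sa : spectrum(a) ∩ F = ∅}` is dense in the
selfadjoint part `A_sa` with the norm topology. -/
theorem stmt_13 {A : Type*} [CStarAlgebra A]
    (hA : ∀ a : A, IsSelfAdjoint a → ∀ ε > 0,
      ∃ b : A, IsSelfAdjoint b ∧ (spectrum ℂ b).Finite ∧ ‖a - b‖ < ε)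
    (F : Set ℝ) (hF : F.Finite) :
    Dense {a : {x : A // IsSelfAdjoint x} |
      spectrum ℂ (a : A) ∩ (Complex.ofReal '' F) = ∅} := by
  intro a
  rw [Metric.mem_closure_iff]
  intro ε hε
  obtain ⟨b, hb, hbfin, hab⟩ := hA a a.2 (ε / 2) (half_pos hε)
  obtain ⟨t, ht0, htε, ht⟩ := exists_pos_lt_forall_add_ne hbfin hF (half_pos hε)
  have hsa : IsSelfAdjoint (b + algebraMap ℂ A (t : ℂ)) :=
    hb.add (IsSelfAdjoint.algebraMap A (Complex.conj_ofReal t))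
  refine ⟨⟨_, hsa⟩, ?_, ?_⟩
  · refine Set.eq_empty_iff_forall_notMem.mpr ?_
    rintro _ ⟨hz, f, hf, rfl⟩
    refine ht (f - t) ?_ f hf (sub_add_cancel _ _)
    rw [← spectrum.add_mem_add_iff (s := (t : ℂ)), sub_add_cancel, add_comm]
    exact hz
  · have hnorm : ‖algebraMap ℂ A (t : ℂ)‖ ≤ t := by
      cases subsingleton_or_nontrivial A
      · rw [Subsingleton.elim (algebraMap ℂ A (t : ℂ)) 0, norm_zero]
        exact ht0.le
      · rw [norm_algebraMap', Complex.norm_real, Real.norm_of_nonneg ht0.le]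
    calc dist (a : A) (b + algebraMap ℂ A (t : ℂ))
        = ‖((a : A) - b) - algebraMap ℂ A (t : ℂ)‖ := by rw [dist_eq_norm, sub_sub]
      _ ≤ ‖(a : A) - b‖ + ‖algebraMap ℂ A (t : ℂ)‖ := norm_sub_le _ _
      _ < ε := by linarith
end

section
/- Let G be a second countable, locally compact, Hausdorff, totally disconnected topological space, let X be a Hausdorff topological space, and let r, s : G → X be local homeomorphisms. Let S ⊆ G be a compact set such that the restrictions of both r and s to S are injective. Then there exists a compact open set T ⊆ G with S ⊆ T such that the restrictions of both r and s to T are injective. -/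
open Set Topology

/-- In a locally compact, Hausdorff, totally disconnected space, every compact subset of an open
set `U` is contained in a compact open subset of `U`. -/
lemma IsCompact.exists_isCompact_isOpen_between {G : Type*} [TopologicalSpace G]
    [LocallyCompactSpace G] [T2Space G] [TotallyDisconnectedSpace G] {S U : Set G}
    (hS : IsCompact S) (hU : IsOpen U) (hSU : S ⊆ U) :
    ∃ T : Set G, IsCompact T ∧ IsOpen T ∧ S ⊆ T ∧ T ⊆ U := by
  obtain ⟨K, hK, hSK, hKU⟩ := exists_compact_between hS hU hSU
  obtain ⟨T, hT, hST, hTK⟩ : ∃ T : Set G, IsClopen T ∧ S ⊆ T ∧ T ⊆ interior K := by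
    refine hS.induction_on (p := fun A ↦ ∃ T, IsClopen T ∧ A ⊆ T ∧ T ⊆ interior K) ?_ ?_ ?_ ?_
    · exact ⟨∅, isClopen_empty, subset_rfl, empty_subset _⟩
    · rintro A B hAB ⟨T, hT, hBT, hTK⟩
      exact ⟨T, hT, hAB.trans hBT, hTK⟩
    · rintro A B ⟨T, hT, hAT, hTK⟩ ⟨T', hT', hBT', hTK'⟩
      exact ⟨T ∪ T', hT.union hT', union_subset_union hAT hBT', union_subset hTK hTK'⟩
    · intro x hx
      obtain ⟨T, hT, hxT, hTK⟩ := loc_compact_Haus_tot_disc_of_zero_dim.mem_nhds_iff.1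
        (isOpen_interior.mem_nhds (hSK hx))
      exact ⟨T, mem_nhdsWithin_of_mem_nhds (hT.isOpen.mem_nhds hxT), T, hT, subset_rfl, hTK⟩
  have hTK' := hTK.trans interior_subset
  exact ⟨T, hK.of_isClosed_subset hT.isClosed hTK', hT.isOpen, hST, hTK'.trans hKU⟩

/-- A local homeomorphism to a Hausdorff space which is injective on a compact set is injective on
an open neighbourhood of that set. -/
lemma IsLocalHomeomorph.exists_isOpen_superset_injOn {G X : Type*} [TopologicalSpace G]
    [TopologicalSpace X] [T2Space X] {f : G → X} (hf : IsLocalHomeomorph f) {S : Set G}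
    (hS : IsCompact S) (hfS : InjOn f S) : ∃ U : Set G, IsOpen U ∧ S ⊆ U ∧ InjOn f U :=
  hfS.exists_isOpen_superset hS (fun _ _ ↦ hf.continuous.continuousAt) fun x _ ↦ by
    obtain ⟨e, hx, rfl⟩ := hf x
    exact ⟨e.source, e.open_source.mem_nhds hx, e.injOn⟩

/-- Let `G` be a second countable, locally compact, Hausdorff, totally
disconnected space, `X` a Hausdorff space, and `r, s : G → X` local homeomorphisms.
If `S ⊆ G` is compact and both `r` and `s` are injective on `S`, then there is a compact
open set `T ⊇ S` on which both `r` and `s` are injective. -/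
theorem stmt_14 {G X : Type*} [TopologicalSpace G] [TopologicalSpace X]
    [SecondCountableTopology G] [LocallyCompactSpace G] [T2Space G]
    [TotallyDisconnectedSpace G] [T2Space X]
    (r s : G → X) (hr : IsLocalHomeomorph r) (hs : IsLocalHomeomorph s)
    (S : Set G) (hS : IsCompact S)
    (hrS : Set.InjOn r S) (hsS : Set.InjOn s S) :
    ∃ T : Set G, IsCompact T ∧ IsOpen T ∧ S ⊆ T ∧ Set.InjOn r T ∧ Set.InjOn s T := by
  obtain ⟨U, hU, hSU, hrU⟩ := hr.exists_isOpen_superset_injOn hS hrS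
  obtain ⟨V, hV, hSV, hsV⟩ := hs.exists_isOpen_superset_injOn hS hsS
  obtain ⟨T, hT, hTo, hST, hTUV⟩ :=
    hS.exists_isCompact_isOpen_between (hU.inter hV) (subset_inter hSU hSV)
  exact ⟨T, hT, hTo, hST, hrU.mono (hTUV.trans inter_subset_left),
    hsV.mono (hTUV.trans inter_subset_right)⟩
end

section
/- Let G be a locally compact, Hausdorff, totally disconnected topological space, let X be a topological space, and let r, s : G → X be local homeomorphisms. Let K ⊆ G be a compact set. Then there exist finitely many pairwise disjoint compact sets K₁, …, Kₙ ⊆ G with K = K₁ ∪ ⋯ ∪ Kₙ such that the restrictions of both r and s to each Kᵢ are injective; moreover, if K is open, the sets K₁, …, Kₙ can be chosen to be open as well. -/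
/-- The disjointification of a finite sequence of clopen sets consists of clopen sets. -/
theorem isClopen_disjointed_fin {G : Type*} [TopologicalSpace G] {n : ℕ} {f : Fin n → Set G}
    (hf : ∀ i, IsClopen (f i)) (i : Fin n) : IsClopen (disjointed f i) := by
  rw [disjointed_eq_inter_compl]
  exact (hf i).inter ((Set.toFinite _).isClopen_biInter fun j _ => (hf j).compl)

/-- A local homeomorphism is injective on an open neighbourhood of every point. -/
theorem IsLocalHomeomorph.exists_isOpen_injOn {G X : Type*} [TopologicalSpace G]
    [TopologicalSpace X] {f : G → X} (hf : IsLocalHomeomorph f) (x : G) :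
    ∃ U, IsOpen U ∧ x ∈ U ∧ Set.InjOn f U := by
  obtain ⟨e, hx, rfl⟩ := hf x
  exact ⟨e.source, e.open_source, hx, e.injOn⟩

/-- Let `G` be a locally compact, Hausdorff, totally disconnected space,
`X` a topological space, and `r, s : G → X` local homeomorphisms.  Every compact
`K ⊆ G` is a finite disjoint union of compact sets on each of which both `r` and `s`
are injective; moreover, if `K` is open, these sets can be chosen open as well. -/
theorem stmt_15 {G X : Type*} [TopologicalSpace G] [TopologicalSpace X]
    [LocallyCompactSpace G] [T2Space G] [TotallyDisconnectedSpace G]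
    (r s : G → X) (hr : IsLocalHomeomorph r) (hs : IsLocalHomeomorph s)
    (K : Set G) (hK : IsCompact K) :
    ∃ (n : ℕ) (K' : Fin n → Set G),
      (⋃ i, K' i) = K ∧
      (Pairwise fun i j => Disjoint (K' i) (K' j)) ∧
      (∀ i, IsCompact (K' i)) ∧
      (∀ i, Set.InjOn r (K' i)) ∧
      (∀ i, Set.InjOn s (K' i)) ∧
      (IsOpen K → ∀ i, IsOpen (K' i)) := by
  have hloc (x : G) : ∃ V, IsClopen V ∧ x ∈ V ∧ Set.InjOn r V ∧ Set.InjOn s V := by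
    obtain ⟨U, hU, hxU, hrU⟩ := hr.exists_isOpen_injOn x
    obtain ⟨W, hW, hxW, hsW⟩ := hs.exists_isOpen_injOn x
    obtain ⟨V, hV, hxV, hVUW⟩ := loc_compact_Haus_tot_disc_of_zero_dim.exists_subset_of_mem_open
      (Set.mem_inter hxU hxW) (hU.inter hW)
    exact ⟨V, hV, hxV, hrU.mono fun _ h => (hVUW h).1, hsW.mono fun _ h => (hVUW h).2⟩
  choose V hV hxV hrV hsV using hloc
  obtain ⟨t, -, ht⟩ := hK.elim_nhds_subcover V fun x _ => (hV x).isOpen.mem_nhds (hxV x)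
  let f : Fin t.card → Set G := fun i => V (t.equivFin.symm i)
  have hD : ∀ i, IsClopen (disjointed f i) := isClopen_disjointed_fin fun _ => hV _
  have hDf (i) : K ∩ disjointed f i ⊆ f i := Set.inter_subset_right.trans (disjointed_subset f i)
  refine ⟨t.card, fun i => K ∩ disjointed f i, ?_, fun i j hij => ?_,
    fun i => hK.inter_right (hD i).isClosed, fun i => (hrV _).mono (hDf i),
    fun i => (hsV _).mono (hDf i), fun hKo i => hKo.inter (hD i).isOpen⟩
  · rw [← Set.inter_iUnion, iUnion_disjointed, Set.inter_eq_left]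
    intro x hx
    obtain ⟨y, hy, hxy⟩ := Set.mem_iUnion₂.1 (ht hx)
    exact Set.mem_iUnion.2 ⟨t.equivFin ⟨y, hy⟩, by simpa [f] using hxy⟩
  · exact (disjoint_disjointed f hij).mono Set.inter_subset_right Set.inter_subset_right
end
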